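/- Let X be a UMD Banach space and (d_n)_{n≥1} an X-valued martingale difference sequence. Then for any 1 ≤ p < ∞, E sup_{m≥1} ‖Σ_{n=1}^m d_n‖^p ≍_{p,X} E ‖(d_n)_{n=1}^∞‖_{γ(ℓ²,X)}^p, with implicit constants depending only on p and X. -/

import Mathlib

open MeasureTheory ProbabilityTheory Filter
open scoped ENNReal NNReal Topology RealInnerProductSpace Classical

noncomputable section

/-- The law of `N` i.i.d. standard Gaussian random variables. -/
def gaussianPi (N : ℕ) : Measure (Fin N → ℝ) :=
  Measure.pi fun _ => gaussianReal 0 1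

/-- The `γ(ℓ²,X)`-norm of a sequence `(d_n)` in a Banach space `X`:
`(E_γ ‖Σ_n γ_n d_n‖²)^{1/2}` with `(γ_n)` i.i.d. standard Gaussians. -/
noncomputable def gammaSeqNorm {X : Type*} [NormedAddCommGroup X] [NormedSpace ℝ X]
    (d : ℕ → X) : ℝ≥0∞ :=
  ⨆ N : ℕ, (∫⁻ g : Fin N → ℝ, (‖∑ i : Fin N, g i • d i‖₊ : ℝ≥0∞) ^ 2 ∂ gaussianPi N) ^ (1 / 2 : ℝ)

/-- `(d_n)` is an `X`-valued martingale difference sequence w.r.t. the filtration `ℱ`,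
i.e. the partial sums `f_m = Σ_{n<m} d_n` form a martingale. -/
def IsMartDiffSeq {Ω X : Type*} [NormedAddCommGroup X] [NormedSpace ℝ X] [CompleteSpace X]
    {m : MeasurableSpace Ω} (ℱ : Filtration ℕ m) (P : Measure Ω) (d : ℕ → Ω → X) : Prop :=
  Martingale (fun n ω => ∑ j ∈ Finset.range n, d j ω) ℱ P

/-- `X` is a UMD Banach space: for all `p ∈ (1,∞)` there is `β > 0` such that for every
martingale difference sequence `(d_j)` and every choice of signs `(ε_j)`,
`(E‖Σ_{j<n} ε_j d_j‖^p)^{1/p} ≤ β (E‖Σ_{j<n} d_j‖^p)^{1/p}`. -/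
def IsUMD (X : Type*) [NormedAddCommGroup X] [NormedSpace ℝ X] [CompleteSpace X] : Prop :=
  ∀ p : ℝ, 1 < p → ∃ β : ℝ, 0 < β ∧
    ∀ (Ω : Type) (m : MeasurableSpace Ω) (P : Measure Ω), IsProbabilityMeasure P →
      ∀ (ℱ : Filtration ℕ m) (d : ℕ → Ω → X), IsMartDiffSeq ℱ P d →
        ∀ ε : ℕ → ℝ, (∀ j, ε j = 1 ∨ ε j = -1) →
          ∀ n : ℕ,
            (∫⁻ ω, (‖∑ j ∈ Finset.range n, ε j • d j ω‖₊ : ℝ≥0∞) ^ p ∂P) ^ (1 / p) ≤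
              ENNReal.ofReal β * (∫⁻ ω, (‖∑ j ∈ Finset.range n, d j ω‖₊ : ℝ≥0∞) ^ p ∂P) ^ (1 / p)

/-! ### Rademacher sums -/

/-- A sign, viewed as a real number. -/
def signVal (u : ℤˣ) : ℝ := ((u : ℤ) : ℝ)

lemma signVal_mul (u v : ℤˣ) : signVal (u * v) = signVal u * signVal v := by
  simp [signVal]

@[simp] lemma signVal_one : signVal 1 = 1 := by simp [signVal]

@[simp] lemma signVal_neg (u : ℤˣ) : signVal (-u) = -signVal u := by simp [signVal]

lemma signVal_eq (u : ℤˣ) : signVal u = 1 ∨ signVal u = -1 := by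
  rcases Int.units_eq_one_or u with rfl | rfl <;> simp

@[simp] lemma signVal_mul_self (u : ℤˣ) : signVal u * signVal u = 1 := by
  rcases signVal_eq u with h | h <;> simp [h]

/-- The signed sum `∑ εᵢ xᵢ`. -/
def radSum {ι X : Type*} [Fintype ι] [NormedAddCommGroup X] [NormedSpace ℝ X]
    (x : ι → X) (ε : ι → ℤˣ) : X :=
  ∑ i, signVal (ε i) • x i

section Rademacher

open scoped BigOperators

variable {X : Type*} [NormedAddCommGroup X] [NormedSpace ℝ X]
variable {ι : Type*} [Fintype ι] [DecidableEq ι]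

lemma radSum_mul (x : ι → X) (δ ε : ι → ℤˣ) :
    radSum x (δ * ε) = radSum (fun i => signVal (δ i) • x i) ε := by
  simp [radSum, signVal_mul, smul_smul, mul_comm]

lemma expect_mul_left (δ : ι → ℤˣ) (f : (ι → ℤˣ) → ℝ) : 𝔼 ε, f (δ * ε) = 𝔼 ε, f ε :=
  Fintype.expect_equiv (Equiv.mulLeft δ) _ _ fun _ => rfl

lemma expect_mono {α : Type*} [Fintype α] {f g : α → ℝ} (h : ∀ a, f a ≤ g a) :
    𝔼 a, f a ≤ 𝔼 a, g a :=
  Finset.expect_le_expect fun a _ => h a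

lemma expect_nonneg' {α : Type*} [Fintype α] {f : α → ℝ} (h : ∀ a, 0 ≤ f a) : 0 ≤ 𝔼 a, f a :=
  Finset.expect_nonneg fun a _ => h a

lemma expect_eq_sum_weights {α : Type*} [Fintype α] (f : α → ℝ) :
    𝔼 a, f a = ∑ a, (Fintype.card α : ℝ)⁻¹ * f a := by
  rw [Fintype.expect_eq_sum_div_card, ← Finset.mul_sum, div_eq_inv_mul]

lemma expect_pow_le {α : Type*} [Fintype α] [Nonempty α] {f : α → ℝ} (hf : ∀ a, 0 ≤ f a) (n : ℕ) :
    (𝔼 a, f a) ^ n ≤ 𝔼 a, f a ^ n := by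
  simp only [expect_eq_sum_weights]
  exact Real.pow_arith_mean_le_arith_mean_pow _ _ _ (fun _ _ => by positivity) (by simp)
    (fun a _ => hf a) n

lemma expect_rpow_le {α : Type*} [Fintype α] [Nonempty α] {f : α → ℝ} (hf : ∀ a, 0 ≤ f a) {p : ℝ}
    (hp : 1 ≤ p) : (𝔼 a, f a) ^ p ≤ 𝔼 a, f a ^ p := by
  simp only [expect_eq_sum_weights]
  exact Real.rpow_arith_mean_le_arith_mean_rpow _ _ _ (fun _ _ => by positivity) (by simp)
    (fun a _ => hf a) hp

/-- The contraction principle. -/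
lemma expect_radSum_contraction (x : ι → X) (a : ι → ℝ) {M : ℝ} (ha : ∀ i, |a i| ≤ M) :
    𝔼 ε, ‖radSum (fun i => a i • x i) ε‖ ^ 2 ≤ M ^ 2 * 𝔼 ε, ‖radSum x ε‖ ^ 2 := by
  let φ : (ι → ℝ) → ℝ := fun a => 𝔼 ε, ‖radSum (fun i => a i • x i) ε‖ ^ 2
  have hφ : ConvexOn ℝ Set.univ φ := by
    refine ⟨convex_univ, fun a _ b _ s t hs ht hst => ?_⟩
    simp only [φ, smul_eq_mul, Finset.mul_expect, ← Finset.expect_add_distrib]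
    refine expect_mono fun ε => ?_
    have h : radSum (fun i => (s • a + t • b) i • x i) ε =
        s • radSum (fun i => a i • x i) ε + t • radSum (fun i => b i • x i) ε := by
      simp only [radSum, Finset.smul_sum, ← Finset.sum_add_distrib]
      refine Finset.sum_congr rfl fun i _ => ?_
      simp only [Pi.add_apply, Pi.smul_apply, smul_eq_mul, add_smul, smul_add, smul_smul]
      congr 2 <;> ring
    have hsq : ConvexOn ℝ Set.univ (fun y : X => ‖y‖ ^ 2) :=
      (convexOn_univ_norm (E := X)).pow (fun _ _ => norm_nonneg _) 2
    simpa only [h, smul_eq_mul] using hsq.2 (Set.mem_univ _) (Set.mem_univ _) hs ht hst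
  rcases isEmpty_or_nonempty ι with hι | ⟨⟨i₀⟩⟩
  · simp [radSum]
  have hM : 0 ≤ M := (abs_nonneg _).trans (ha i₀)
  have hmem : a ∈ convexHull ℝ (Set.univ.pi fun _ : ι => ({-M, M} : Set ℝ)) := by
    rw [convexHull_pi]
    intro i _
    rw [convexHull_pair, segment_eq_Icc (by linarith)]
    exact abs_le.1 (ha i)
  obtain ⟨y, hy, hle⟩ := hφ.exists_ge_of_mem_convexHull (Set.subset_univ _) hmem
  refine hle.trans (le_of_eq ?_)
  have hδ : ∀ i, ∃ u : ℤˣ, y i = signVal u * M := fun i => by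
    rcases hy i trivial with h | h
    · exact ⟨-1, by simp [h]⟩
    · exact ⟨1, by simpa using h⟩
  choose δ hδ using hδ
  have h : ∀ ε, ‖radSum (fun i => y i • x i) ε‖ ^ 2 = M ^ 2 * ‖radSum x (δ * ε)‖ ^ 2 := fun ε => by
    have : radSum (fun i => y i • x i) ε = M • radSum x (δ * ε) := by
      simp only [radSum, Finset.smul_sum, smul_smul, hδ, Pi.mul_apply, signVal_mul]
      refine Finset.sum_congr rfl fun i _ => ?_
      congr 1; ring
    rw [this, norm_smul, mul_pow, Real.norm_eq_abs, sq_abs]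
  simp only [φ, h, ← Finset.mul_expect]
  rw [expect_mul_left δ (fun ε => ‖radSum x ε‖ ^ 2)]

/-- Scalar two-point hypercontractivity with exponent `2k`. -/
lemma two_point_scalar (k : ℕ) (a b : ℝ) :
    ((a + (2 ^ k)⁻¹ * b) ^ (2 * k) + (a - (2 ^ k)⁻¹ * b) ^ (2 * k)) / 2 ≤ (a ^ 2 + b ^ 2) ^ k := by
  set ρ : ℝ := (2 ^ k)⁻¹ with hρ
  have hρk : ρ ^ 2 * (4 * k) ≤ 1 + 3 * ρ ^ 2 := by
    have h4 : (4 * k : ℝ) ≤ 4 ^ k + 3 := by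
      cases k with
      | zero => norm_num
      | succ j =>
        have : j + 1 ≤ 4 ^ j := Nat.lt_pow_self (by norm_num)
        have : ((j : ℝ) + 1) ≤ 4 ^ j := by exact_mod_cast this
        push_cast
        rw [pow_succ]
        linarith
    have h1 : ρ ^ 2 * 4 ^ k = 1 := by
      rw [hρ, inv_pow, ← pow_mul, mul_comm k 2, pow_mul]; norm_num
    nlinarith [sq_nonneg ρ]
  set c := a ^ 2 + ρ ^ 2 * b ^ 2 with hc
  set e := 2 * ρ * a * b with he
  set s := a ^ 2 + b ^ 2 with hs
  have hρ1 : ρ ≤ 1 := inv_le_one_of_one_le₀ (one_le_pow₀ (by norm_num))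
  have hρ0 : 0 ≤ ρ := by positivity
  have hc0 : 0 ≤ c := by positivity
  have hs0 : 0 ≤ s := by positivity
  have hρ2 : ρ ^ 2 ≤ 1 := pow_le_one₀ hρ0 hρ1
  have hcs : c ≤ s := by
    have : ρ ^ 2 * b ^ 2 ≤ 1 * b ^ 2 := by gcongr
    simp only [hc, hs]; linarith
  have key : ∀ m : ℕ, m + 1 ≤ k → ((c + e) ^ (m + 1) + (c - e) ^ (m + 1)) / 2 ≤ s ^ (m + 1) ∧
      e * (((c + e) ^ (m + 1) - (c - e) ^ (m + 1)) / 2) ≤ (m + 1) * e ^ 2 * s ^ m := by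
    intro m
    induction m with
    | zero => intro _; constructor <;> ring_nf <;> linarith
    | succ m ih =>
      intro hm
      obtain ⟨h1, h2⟩ := ih (by omega)
      have hmk : ((m : ℝ) + 1) + 1 ≤ k := by exact_mod_cast hm
      set S := ((c + e) ^ (m + 1) + (c - e) ^ (m + 1)) / 2
      set T := ((c + e) ^ (m + 1) - (c - e) ^ (m + 1)) / 2
      have hS : ((c + e) ^ (m + 1 + 1) + (c - e) ^ (m + 1 + 1)) / 2 = c * S + e * T := by
        simp only [S, T]; ring
      have hT : e * (((c + e) ^ (m + 1 + 1) - (c - e) ^ (m + 1 + 1)) / 2) =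
          c * (e * T) + e ^ 2 * S := by
        simp only [S, T]; ring
      rw [hS, hT]
      constructor
      · have h3 : c * s + (m + 1) * e ^ 2 ≤ s ^ 2 := by
          have h5 : (m + 1) * (4 * ρ ^ 2) ≤ 1 - ρ ^ 2 := by nlinarith [sq_nonneg ρ]
          have h6 : (m + 1) * (4 * ρ ^ 2) * (a ^ 2 * b ^ 2) ≤ (1 - ρ ^ 2) * (s * b ^ 2) := by
            have h8 : a ^ 2 * b ^ 2 ≤ s * b ^ 2 := by
              have : a ^ 2 ≤ s := by simp only [hs]; nlinarith [sq_nonneg b]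
              gcongr
            calc _ ≤ (1 - ρ ^ 2) * (a ^ 2 * b ^ 2) := by gcongr
              _ ≤ _ := mul_le_mul_of_nonneg_left h8 (by linarith)
          have h7 : s ^ 2 - c * s = (1 - ρ ^ 2) * (s * b ^ 2) := by simp only [hs, hc]; ring
          have : (m + 1) * e ^ 2 = (m + 1) * (4 * ρ ^ 2) * (a ^ 2 * b ^ 2) := by
            simp only [he]; ring
          linarith
        calc c * S + e * T ≤ c * s ^ (m + 1) + (m + 1) * e ^ 2 * s ^ m := by gcongr
          _ = s ^ m * (c * s + (m + 1) * e ^ 2) := by ring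
          _ ≤ s ^ m * s ^ 2 := by gcongr
          _ = _ := by ring
      · push_cast
        calc c * (e * T) + e ^ 2 * S ≤ c * ((m + 1) * e ^ 2 * s ^ m) + e ^ 2 * s ^ (m + 1) := by
              gcongr
          _ ≤ s * ((m + 1) * e ^ 2 * s ^ m) + e ^ 2 * s ^ (m + 1) := by gcongr
          _ = _ := by ring
  have h1 : (a + ρ * b) ^ 2 = c + e := by simp only [hc, he]; ring
  have h2 : (a - ρ * b) ^ 2 = c - e := by simp only [hc, he]; ring
  rw [pow_mul, pow_mul, h1, h2]
  cases k with
  | zero => simp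
  | succ k => exact (key k le_rfl).1

lemma two_point_norm (k : ℕ) (x y : X) :
    (‖x + ((2 : ℝ) ^ k)⁻¹ • y‖ ^ (2 * k) + ‖x - ((2 : ℝ) ^ k)⁻¹ • y‖ ^ (2 * k)) / 2 ≤
      ((‖x + y‖ ^ 2 + ‖x - y‖ ^ 2) / 2) ^ k := by
  set ρ : ℝ := (2 ^ k)⁻¹ with hρ
  have hρ0 : 0 ≤ ρ := by positivity
  have hρ1 : ρ ≤ 1 := inv_le_one_of_one_le₀ (one_le_pow₀ (by norm_num))
  set a := (‖x + y‖ + ‖x - y‖) / 2 with ha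
  set b := (‖x + y‖ - ‖x - y‖) / 2 with hb
  have h1 : ‖x + ρ • y‖ ≤ a + ρ * b := by
    have : x + ρ • y = ((1 + ρ) / 2) • (x + y) + ((1 - ρ) / 2) • (x - y) := by module
    rw [this]
    refine (norm_add_le _ _).trans (le_of_eq ?_)
    rw [norm_smul, norm_smul, Real.norm_of_nonneg (by linarith), Real.norm_of_nonneg (by linarith)]
    rw [ha, hb]; ring
  have h2 : ‖x - ρ • y‖ ≤ a - ρ * b := by
    have : x - ρ • y = ((1 - ρ) / 2) • (x + y) + ((1 + ρ) / 2) • (x - y) := by module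
    rw [this]
    refine (norm_add_le _ _).trans (le_of_eq ?_)
    rw [norm_smul, norm_smul, Real.norm_of_nonneg (by linarith), Real.norm_of_nonneg (by linarith)]
    rw [ha, hb]; ring
  have h3 : (‖x + y‖ ^ 2 + ‖x - y‖ ^ 2) / 2 = a ^ 2 + b ^ 2 := by rw [ha, hb]; ring
  rw [h3]
  refine le_trans ?_ (two_point_scalar k a b)
  gcongr

lemma expect_fin_succ {n : ℕ} (f : (Fin (n + 1) → ℤˣ) → ℝ) :
    𝔼 ε, f ε = 𝔼 ε : Fin n → ℤˣ, (f (Fin.cons 1 ε) + f (Fin.cons (-1) ε)) / 2 := by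
  rw [← Fintype.expect_equiv (Fin.consEquiv fun _ => ℤˣ) (fun q => f (Fin.cons q.1 q.2)) f
    (fun _ => rfl), ← Finset.univ_product_univ, Finset.expect_product, Finset.expect_comm]
  refine Finset.expect_congr rfl fun ε _ => ?_
  rw [Fintype.expect_eq_sum_div_card]
  simp [UnitsInt.univ]

lemma expect_half_add_pow_le {α : Type*} [Fintype α] [Nonempty α] {k : ℕ} (hk : k ≠ 0)
    {U V : α → ℝ} (hU : ∀ a, 0 ≤ U a) (hV : ∀ a, 0 ≤ V a) {s t : ℝ} (hs : 0 ≤ s) (ht : 0 ≤ t)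
    (hUs : 𝔼 a, U a ^ k ≤ s ^ k) (hVt : 𝔼 a, V a ^ k ≤ t ^ k) :
    𝔼 a, ((U a + V a) / 2) ^ k ≤ ((s + t) / 2) ^ k := by
  have hk1 : (1 : ℝ) ≤ k := by exact_mod_cast Nat.one_le_iff_ne_zero.2 hk
  have hN : (0 : ℝ) < Fintype.card α := by exact_mod_cast Fintype.card_pos
  have h := Real.Lp_add_le_of_nonneg Finset.univ hk1 (fun a _ => hU a) (fun a _ => hV a)
  simp only [Real.rpow_natCast] at h
  have hb : ∀ {W : α → ℝ} {w : ℝ}, (∀ a, 0 ≤ W a) → 0 ≤ w → 𝔼 a, W a ^ k ≤ w ^ k →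
      (∑ a, W a ^ k) ^ (1 / (k : ℝ)) ≤ (Fintype.card α : ℝ) ^ (1 / (k : ℝ)) * w := by
    intro W w hW hw hle
    rw [Fintype.expect_eq_sum_div_card, div_le_iff₀ hN] at hle
    have h0 : 0 ≤ ∑ a, W a ^ k := Finset.sum_nonneg fun a _ => pow_nonneg (hW a) k
    calc _ ≤ (w ^ k * (Fintype.card α : ℝ)) ^ (1 / (k : ℝ)) := by gcongr
      _ = _ := by
        rw [Real.mul_rpow (by positivity) hN.le, one_div, Real.pow_rpow_inv_natCast hw hk, mul_comm]
  have h2 := h.trans (add_le_add (hb hU hs hUs) (hb hV ht hVt))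
  rw [← mul_add] at h2
  have h0 : 0 ≤ ∑ a, (U a + V a) ^ k :=
    Finset.sum_nonneg fun a _ => pow_nonneg (add_nonneg (hU a) (hV a)) k
  have h3 : ∑ a, (U a + V a) ^ k ≤ Fintype.card α * (s + t) ^ k := by
    calc _ = ((∑ a, (U a + V a) ^ k) ^ (1 / (k : ℝ))) ^ k := by
          rw [one_div, Real.rpow_inv_natCast_pow h0 hk]
      _ ≤ ((Fintype.card α : ℝ) ^ (1 / (k : ℝ)) * (s + t)) ^ k := by gcongr
      _ = _ := by rw [mul_pow, one_div, Real.rpow_inv_natCast_pow hN.le hk]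
  rw [Fintype.expect_eq_sum_div_card, div_le_iff₀ hN]
  simp only [div_pow, ← Finset.sum_div]
  rw [div_mul_eq_mul_div]
  gcongr
  linarith

lemma hypercontractive (k : ℕ) (hk : k ≠ 0) (n : ℕ) (z : X) (x : Fin n → X) :
    𝔼 ε, ‖z + ((2 : ℝ) ^ k)⁻¹ • radSum x ε‖ ^ (2 * k) ≤ (𝔼 ε, ‖z + radSum x ε‖ ^ 2) ^ k := by
  induction n generalizing z with
  | zero => simp [radSum, pow_mul]
  | succ n ih =>
    have hr : ∀ (u : ℤˣ) (ε : Fin n → ℤˣ),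
        radSum x (Fin.cons u ε) = signVal u • x 0 + radSum (fun i : Fin n => x i.succ) ε := fun u ε => by
      simp [radSum, Fin.sum_univ_succ]
    rw [expect_fin_succ, expect_fin_succ]
    simp only [hr, signVal_one, signVal_neg, one_smul, neg_smul]
    refine (expect_mono fun ε => ?_).trans (le_trans (expect_half_add_pow_le hk
      (U := fun ε => ‖(z + x 0) + ((2 : ℝ) ^ k)⁻¹ • radSum (fun i : Fin n => x i.succ) ε‖ ^ 2)
      (V := fun ε => ‖(z - x 0) + ((2 : ℝ) ^ k)⁻¹ • radSum (fun i : Fin n => x i.succ) ε‖ ^ 2)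
      (s := 𝔼 ε, ‖(z + x 0) + radSum (fun i : Fin n => x i.succ) ε‖ ^ 2)
      (t := 𝔼 ε, ‖(z - x 0) + radSum (fun i : Fin n => x i.succ) ε‖ ^ 2)
      (fun _ => by positivity) (fun _ => by positivity)
      (expect_nonneg' fun _ => by positivity) (expect_nonneg' fun _ => by positivity)
      ?_ ?_) (le_of_eq ?_))
    · have := two_point_norm k (z + ((2 : ℝ) ^ k)⁻¹ • radSum (fun i : Fin n => x i.succ) ε) (x 0)
      have e1 : ∀ r : X, z + ((2 : ℝ) ^ k)⁻¹ • (x 0 + r) =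
          z + ((2 : ℝ) ^ k)⁻¹ • r + ((2 : ℝ) ^ k)⁻¹ • x 0 := fun r => by module
      have e2 : ∀ r : X, z + ((2 : ℝ) ^ k)⁻¹ • (-x 0 + r) =
          z + ((2 : ℝ) ^ k)⁻¹ • r - ((2 : ℝ) ^ k)⁻¹ • x 0 := fun r => by module
      rw [e1, e2]
      refine this.trans (le_of_eq ?_)
      simp only [add_right_comm, sub_eq_add_neg]
    · simpa only [← pow_mul] using ih (z + x 0) fun i : Fin n => x i.succ
    · simpa only [← pow_mul] using ih (z - x 0) fun i : Fin n => x i.succ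
    · congr 1
      rw [← Finset.expect_add_distrib, Finset.expect_div]
      refine Finset.expect_congr rfl fun ε _ => ?_
      simp only [add_assoc, sub_eq_add_neg]

/-- Kahane's inequality, from an even exponent to the exponent two. -/
lemma kahane_even (k : ℕ) (hk : k ≠ 0) {n : ℕ} (x : Fin n → X) :
    𝔼 ε, ‖radSum x ε‖ ^ (2 * k) ≤ (2 ^ k) ^ (2 * k) * (𝔼 ε, ‖radSum x ε‖ ^ 2) ^ k := by
  have h := hypercontractive k hk n 0 x
  simp only [zero_add, norm_smul, mul_pow, ← Finset.mul_expect] at h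
  rw [norm_inv, norm_pow, Real.norm_ofNat, inv_pow] at h
  rwa [inv_mul_le_iff₀ (by positivity)] at h

/-- Kahane's inequality, from the exponent two to the exponent one. -/
lemma kahane_one {n : ℕ} (x : Fin n → X) :
    𝔼 ε, ‖radSum x ε‖ ^ 2 ≤ 2 ^ 11 * (𝔼 ε, ‖radSum x ε‖) ^ 2 := by
  set A := 𝔼 ε, ‖radSum x ε‖ ^ 2 with hA
  set B := 𝔼 ε, ‖radSum x ε‖ with hB
  have hA0 : 0 ≤ A := expect_nonneg' fun _ => by positivity
  have hB0 : 0 ≤ B := expect_nonneg' fun _ => by positivity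
  have h4 := kahane_even 2 (by norm_num) x
  rw [← hA] at h4
  rcases hA0.eq_or_lt with h0 | hpos
  · rw [← h0]; positivity
  set t := Real.sqrt (2 ^ 9 * A) with ht
  have ht2 : t ^ 2 = 2 ^ 9 * A := Real.sq_sqrt (by positivity)
  have htpos : 0 < t := Real.sqrt_pos.2 (by positivity)
  have hpt : ∀ y : ℝ, 0 ≤ y → y ^ 2 ≤ t * y + (t ^ 2)⁻¹ * y ^ (2 * 2) := fun y hy => by
    rcases le_total y t with h | h
    · have : 0 ≤ (t ^ 2)⁻¹ * y ^ (2 * 2) := by positivity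
      have : y * y ≤ t * y := by gcongr
      nlinarith
    · have : y ^ 2 ≤ (t ^ 2)⁻¹ * y ^ (2 * 2) := by
        rw [le_inv_mul_iff₀ (by positivity)]
        rw [pow_mul, sq (y ^ 2)]
        gcongr
      have : 0 ≤ t * y := by positivity
      linarith
  have h1 : A ≤ t * B + (t ^ 2)⁻¹ * 𝔼 ε, ‖radSum x ε‖ ^ (2 * 2) := by
    rw [hA, hB, Finset.mul_expect, Finset.mul_expect, ← Finset.expect_add_distrib]
    exact expect_mono fun ε => hpt _ (norm_nonneg _)
  have h2 : (t ^ 2)⁻¹ * 𝔼 ε, ‖radSum x ε‖ ^ (2 * 2) ≤ A / 2 := by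
    rw [inv_mul_le_iff₀ (by positivity), ht2]
    refine h4.trans (le_of_eq ?_)
    ring
  have h3 : A ≤ 2 * (t * B) := by linarith
  have h5 : A ^ 2 ≤ (2 * (t * B)) ^ 2 := by gcongr
  have h6 : (2 * (t * B)) ^ 2 = 2 ^ 11 * B ^ 2 * A := by
    rw [mul_pow, mul_pow, ht2]; ring
  rw [h6, sq A] at h5
  exact le_of_mul_le_mul_right h5 hpos

/-- Both sides of the Kahane inequalities between the exponents `p ≥ 1` and two. -/
lemma kahane (p : ℝ) (hp : 1 ≤ p) : ∃ K : ℝ, 0 < K ∧ ∀ (n : ℕ) (x : Fin n → X),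
    (𝔼 ε, ‖radSum x ε‖ ^ p) ≤ K * Real.sqrt (𝔼 ε, ‖radSum x ε‖ ^ 2) ^ p ∧
    Real.sqrt (𝔼 ε, ‖radSum x ε‖ ^ 2) ^ p ≤ K * 𝔼 ε, ‖radSum x ε‖ ^ p := by
  obtain ⟨k, hk⟩ := exists_nat_ge p
  have hp0 : 0 < p := by linarith
  have hkpos : (0 : ℝ) < k := by linarith
  have hk0 : k ≠ 0 := by rintro rfl; simp at hkpos
  refine ⟨(2 ^ k) ^ p + 64 ^ p, by positivity, fun n x => ?_⟩
  set A := 𝔼 ε, ‖radSum x ε‖ ^ 2 with hA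
  set M := 𝔼 ε, ‖radSum x ε‖ ^ p with hM
  have hA0 : 0 ≤ A := expect_nonneg' fun _ => by positivity
  have hM0 : 0 ≤ M := expect_nonneg' fun _ => by positivity
  set σ := Real.sqrt A with hσ
  have hσ0 : 0 ≤ σ := Real.sqrt_nonneg _
  have hσA : σ ^ 2 = A := Real.sq_sqrt hA0
  have h2k : 1 ≤ 2 * k / p := by rw [le_div_iff₀ hp0]; linarith
  constructor
  · have h1 : M ^ (2 * k / p) ≤ (2 ^ k * σ) ^ (2 * k) := by
      refine (expect_rpow_le (fun _ => by positivity) h2k).trans ?_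
      have : ∀ ε, (‖radSum x ε‖ ^ p) ^ (2 * k / p) = ‖radSum x ε‖ ^ (2 * k) := fun ε => by
        rw [← Real.rpow_mul (norm_nonneg _), mul_div_cancel₀ _ hp0.ne']
        exact_mod_cast Real.rpow_natCast ‖radSum x ε‖ (2 * k)
      simp only [this]
      refine (kahane_even k hk0 x).trans (le_of_eq ?_)
      rw [← hA, ← hσA, mul_pow, ← pow_mul σ]
    have h2 : M ≤ (2 ^ k * σ) ^ p := by
      have h3 := Real.rpow_le_rpow (by positivity) h1 (show 0 ≤ p / (2 * k) by positivity)
      rw [← Real.rpow_mul hM0, ← Real.rpow_natCast (2 ^ k * σ), ← Real.rpow_mul (by positivity)]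
        at h3
      have e1 : 2 * (k : ℝ) / p * (p / (2 * k)) = 1 := by field_simp
      have e2 : ((2 * k : ℕ) : ℝ) * (p / (2 * k)) = p := by push_cast; field_simp
      rwa [e1, e2, Real.rpow_one] at h3
    rw [Real.mul_rpow (by positivity) hσ0] at h2
    refine h2.trans ?_
    gcongr
    have : (0 : ℝ) ≤ 64 ^ p := by positivity
    linarith
  · set B := 𝔼 ε, ‖radSum x ε‖ with hB
    have hB0 : 0 ≤ B := expect_nonneg' fun _ => by positivity
    have h1 : σ ≤ 64 * B := by
      have := kahane_one x
      rw [← hA, ← hB, ← hσA] at this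
      refine abs_le_of_sq_le_sq' ?_ (by positivity) |>.2
      nlinarith [sq_nonneg B]
    calc σ ^ p ≤ (64 * B) ^ p := by gcongr
      _ = 64 ^ p * B ^ p := Real.mul_rpow (by norm_num) hB0
      _ ≤ 64 ^ p * M := by
        gcongr
        exact expect_rpow_le (fun _ => by positivity) hp
      _ ≤ _ := by
        gcongr
        have : (0 : ℝ) ≤ (2 ^ k) ^ p := by positivity
        linarith

end Rademacher

/-! ### Martingale difference sequences -/

section MartDiff

variable {Ω X : Type*} [NormedAddCommGroup X] [NormedSpace ℝ X] [CompleteSpace X]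
  {m : MeasurableSpace Ω} {ℱ : Filtration ℕ m} {P : Measure Ω} [IsProbabilityMeasure P]
  {d : ℕ → Ω → X}

lemma isMartDiffSeq_of_condExp_eq_zero (hm : ∀ k, StronglyMeasurable[ℱ (k + 1)] (d k))
    (hi : ∀ k, Integrable (d k) P) (h0 : ∀ k, P[d k | ℱ k] =ᵐ[P] 0) : IsMartDiffSeq ℱ P d := by
  refine martingale_of_condExp_sub_eq_zero_nat (fun n => ?_) (fun n => ?_) fun n => ?_
  · exact Finset.stronglyMeasurable_fun_sum _ fun j hj =>
      (hm j).mono (ℱ.mono (Finset.mem_range.1 hj))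
  · exact integrable_finsetSum _ fun j _ => hi j
  · have : ((fun ω => ∑ j ∈ Finset.range (n + 1), d j ω) - fun ω => ∑ j ∈ Finset.range n, d j ω) =
        d n := by
      ext ω; simp [Finset.sum_range_succ]
    rw [this]
    exact h0 n

lemma IsMartDiffSeq.eq_sub (d : ℕ → Ω → X) (k : ℕ) :
    d k = (fun ω => ∑ j ∈ Finset.range (k + 1), d j ω) - fun ω => ∑ j ∈ Finset.range k, d j ω := by
  ext ω; simp [Finset.sum_range_succ]

lemma IsMartDiffSeq.stronglyMeasurable (h : IsMartDiffSeq ℱ P d) (k : ℕ) :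
    StronglyMeasurable[ℱ (k + 1)] (d k) := by
  rw [IsMartDiffSeq.eq_sub d k]
  exact (h.1 (k + 1)).sub ((h.1 k).mono (ℱ.mono k.le_succ))

lemma IsMartDiffSeq.integrable (h : IsMartDiffSeq ℱ P d) (k : ℕ) : Integrable (d k) P := by
  rw [IsMartDiffSeq.eq_sub d k]
  exact (Martingale.integrable h (k + 1)).sub (Martingale.integrable h k)

lemma IsMartDiffSeq.condExp_eq_zero (h : IsMartDiffSeq ℱ P d) (k : ℕ) :
    P[d k | ℱ k] =ᵐ[P] 0 := by
  rw [IsMartDiffSeq.eq_sub d k]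
  refine (condExp_sub (Martingale.integrable h (k + 1)) (Martingale.integrable h k) _).trans ?_
  have h1 := Martingale.condExp_ae_eq h k.le_succ
  have h2 := Martingale.condExp_ae_eq h le_rfl (i := k)
  filter_upwards [h1, h2] with ω h1 h2
  rw [Pi.sub_apply, h1, h2, sub_self, Pi.zero_apply]

/-- Multiplying a martingale difference sequence by bounded predictable factors. -/
lemma IsMartDiffSeq.smul_predictable (h : IsMartDiffSeq ℱ P d) {a : ℕ → Ω → ℝ} {M : ℝ}
    (ha : ∀ k, StronglyMeasurable[ℱ k] (a k)) (hb : ∀ k ω, |a k ω| ≤ M) :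
    IsMartDiffSeq ℱ P fun k ω => a k ω • d k ω := by
  have hi : ∀ k, Integrable (fun ω => a k ω • d k ω) P := fun k =>
    (h.integrable k).bdd_smul M ((ha k).mono (ℱ.le k)).aestronglyMeasurable
      (.of_forall fun ω => hb k ω)
  refine isMartDiffSeq_of_condExp_eq_zero (fun k => ?_) hi fun k => ?_
  · exact ((ha k).mono (ℱ.mono k.le_succ)).smul (h.stronglyMeasurable k)
  · refine (condExp_smul_of_aestronglyMeasurable_left (ha k).aestronglyMeasurable
      (hi k) (h.integrable k)).trans ?_
    filter_upwards [h.condExp_eq_zero k] with ω hω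
    simp [hω]

end MartDiff

/-! ### The UMD inequality for sign filtrations -/

section SignUMD

open scoped BigOperators

/-- The UMD inequality without the outer `p`-th roots. -/
lemma IsUMD.lintegral_le {X : Type*} [NormedAddCommGroup X] [NormedSpace ℝ X] [CompleteSpace X]
    (hX : IsUMD X) {p : ℝ} (hp : 1 < p) : ∃ β : ℝ, 0 < β ∧
    ∀ (Ω : Type) (m : MeasurableSpace Ω) (P : Measure Ω), IsProbabilityMeasure P →
      ∀ (ℱ : Filtration ℕ m) (d : ℕ → Ω → X), IsMartDiffSeq ℱ P d →
        ∀ ε : ℕ → ℝ, (∀ j, ε j = 1 ∨ ε j = -1) → ∀ n : ℕ,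
          ∫⁻ ω, ‖∑ j ∈ Finset.range n, ε j • d j ω‖ₑ ^ p ∂P ≤
            ENNReal.ofReal β * ∫⁻ ω, ‖∑ j ∈ Finset.range n, d j ω‖ₑ ^ p ∂P := by
  have hp0 : 0 < p := by linarith
  obtain ⟨β, hβ, h⟩ := hX p hp
  refine ⟨β ^ p, by positivity, fun Ω m P hP ℱ d hd ε hε n => ?_⟩
  have h1 := ENNReal.rpow_le_rpow (h Ω m P hP ℱ d hd ε hε n) hp0.le
  rw [ENNReal.mul_rpow_of_nonneg _ _ hp0.le, ← ENNReal.rpow_mul, ← ENNReal.rpow_mul,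
    one_div_mul_cancel hp0.ne', ENNReal.rpow_one, ENNReal.rpow_one,
    ENNReal.ofReal_rpow_of_pos hβ] at h1
  exact h1

variable {Ω : Type*} [Fintype Ω] [Nonempty Ω] [MeasurableSpace Ω] [MeasurableSingletonClass Ω]

lemma integral_uniformOn_univ {X : Type*} [NormedAddCommGroup X] [NormedSpace ℝ X]
    [CompleteSpace X] (f : Ω → X) :
    ∫ ω, f ω ∂uniformOn Set.univ = (Fintype.card Ω : ℝ)⁻¹ • ∑ ω, f ω := by
  rw [integral_fintype .of_finite, Finset.smul_sum]
  refine Finset.sum_congr rfl fun ω _ => ?_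
  rw [Measure.real, uniformOn_univ, Measure.count_singleton]
  simp

lemma lintegral_uniformOn_univ (f : Ω → ℝ) (hf : ∀ ω, 0 ≤ f ω) :
    ∫⁻ ω, ENNReal.ofReal (f ω) ∂uniformOn Set.univ = ENNReal.ofReal (𝔼 ω, f ω) := by
  rw [← ofReal_integral_eq_lintegral_ofReal .of_finite (.of_forall hf), integral_uniformOn_univ,
    Fintype.expect_eq_sum_div_card, smul_eq_mul, div_eq_inv_mul]

end SignUMD

section SignFiltration

open scoped BigOperators

variable {ι : Type} [Fintype ι] [DecidableEq ι] {T : ℕ} (e : ι ≃ Fin T)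

/-- Forget the signs with index at least `j`. -/
def truncSign (j : ℕ) (ε : ι → ℤˣ) : ι → ℤˣ := fun s => if (e s : ℕ) < j then ε s else 1

/-- The filtration on the space of signs generated by the coordinates. -/
def signFiltration : @Filtration (ι → ℤˣ) ℕ _ ⊤ :=
  @Filtration.mk _ _ _ ⊤ (fun j => MeasurableSpace.comap (truncSign e j) ⊤) (by
    intro i j hij
    have : truncSign e i = truncSign e i ∘ truncSign e j := by
      ext ε s
      by_cases h : (e s : ℕ) < i
      · simp [truncSign, h, h.trans_le hij]
      · simp [truncSign, h]
    simp only
    rw [this, ← MeasurableSpace.comap_comp]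
    exact MeasurableSpace.comap_mono le_top) (fun _ => le_top)

variable {X : Type*} [NormedAddCommGroup X] [NormedSpace ℝ X] [CompleteSpace X]

/-- The differences `εₜ vₜ(ε)`, enumerated along `e`. -/
def signDiff (v : ι → (ι → ℤˣ) → X) (j : ℕ) (ε : ι → ℤˣ) : X :=
  if h : j < T then signVal (ε (e.symm ⟨j, h⟩)) • v (e.symm ⟨j, h⟩) ε else 0

lemma isMartDiffSeq_signDiff {v : ι → (ι → ℤˣ) → X}
    (hv : ∀ t ε ε', (∀ s, e s < e t → ε s = ε' s) → v t ε = v t ε') :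
    letI : MeasurableSpace (ι → ℤˣ) := ⊤
    IsMartDiffSeq (signFiltration e) (uniformOn Set.univ) (signDiff e v) := by
  letI : MeasurableSpace (ι → ℤˣ) := ⊤
  have : IsProbabilityMeasure (uniformOn (Set.univ : Set (ι → ℤˣ))) :=
    isProbabilityMeasure_uniformOn Set.finite_univ Set.univ_nonempty
  refine isMartDiffSeq_of_condExp_eq_zero (fun k => ?_) (fun k => .of_finite) fun k => ?_
  · have h1 : signDiff e v k = signDiff e v k ∘ truncSign e (k + 1) := by
      ext ε
      simp only [signDiff, Function.comp_apply]
      split_ifs with h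
      · have h2 : ∀ s, (e s : ℕ) ≤ k → truncSign e (k + 1) ε s = ε s := fun s hs => by
          simp [truncSign, Nat.lt_succ_of_le hs]
        rw [h2 _ (by simp), hv _ (truncSign e (k + 1) ε) ε fun s hs => h2 s ?_]
        have := Fin.lt_def.1 hs
        simp at this
        exact this.le
      · rfl
    rw [h1]
    exact StronglyMeasurable.of_discrete.comp_measurable (comap_measurable _)
  · refine (ae_eq_condExp_of_forall_setIntegral_eq ((signFiltration e).le k) .of_finite
      (fun _ _ _ => integrableOn_zero) (fun s hs _ => ?_) aestronglyMeasurable_zero).symm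
    obtain ⟨B, -, rfl⟩ := hs
    refine (integral_zero _ _).trans (Eq.symm ?_)
    rw [← integral_indicator (MeasurableSet.of_discrete), integral_uniformOn_univ, smul_eq_zero]
    right
    by_cases h : k < T
    swap
    · refine Finset.sum_eq_zero fun ε _ => ?_
      simp [Set.indicator, signDiff, h]
    set t := e.symm ⟨k, h⟩ with ht
    have het : (e t : ℕ) = k := by simp [t]
    let σ : (ι → ℤˣ) ≃ (ι → ℤˣ) := Equiv.mulLeft (Pi.mulSingle t (-1))
    have hσt : ∀ ε, σ ε t = -ε t := fun ε => by simp [σ]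
    have hσs : ∀ ε s, s ≠ t → σ ε s = ε s := fun ε s hs => by simp [σ, hs]
    have : IsAddTorsionFree X := .of_isTorsionFree ℝ X
    refine self_eq_neg.1 ?_
    conv_lhs => rw [← Equiv.sum_comp σ]
    rw [← Finset.sum_neg_distrib]
    refine Finset.sum_congr rfl fun ε _ => ?_
    have h1 : truncSign e k (σ ε) = truncSign e k ε := by
      ext s
      by_cases hs : (e s : ℕ) < k
      · have : s ≠ t := by rintro rfl; omega
        simp [truncSign, hs, hσs ε s this]
      · simp [truncSign, hs]
    have h2 : signDiff e v k (σ ε) = -signDiff e v k ε := by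
      simp only [signDiff, h, dif_pos]
      rw [← ht, hσt, signVal_neg, neg_smul, hv t (σ ε) ε]
      intro s hs
      exact hσs ε s (by rintro rfl; exact lt_irrefl _ hs)
    simp only [Set.indicator, Set.mem_preimage, h1, h2]
    split_ifs <;> simp

lemma norm_smul_sum_sq_le {α : Type*} [Fintype α] [Nonempty α] (f : α → X) :
    ‖(Fintype.card α : ℝ)⁻¹ • ∑ a, f a‖ ^ 2 ≤ 𝔼 a, ‖f a‖ ^ 2 := by
  refine le_trans ?_ (expect_pow_le (fun _ => norm_nonneg _) 2)
  gcongr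
  rw [norm_smul, Fintype.expect_eq_sum_div_card, div_eq_inv_mul, norm_inv, Real.norm_natCast]
  gcongr
  exact norm_sum_le _ _

lemma sum_signDiff (v : ι → (ι → ℤˣ) → X) (θ : ι → ℤˣ) (ε : ι → ℤˣ) :
    ∑ j ∈ Finset.range T, (if h : j < T then signVal (θ (e.symm ⟨j, h⟩)) else 1) •
      signDiff e v j ε = ∑ t, signVal (θ t) • signVal (ε t) • v t ε := by
  rw [Finset.sum_range, ← e.sum_comp]
  simp [signDiff]

lemma umd_signs (hX : IsUMD X) : ∃ β : ℝ, 0 < β ∧ ∀ {ι : Type} [Fintype ι] [DecidableEq ι] {T : ℕ}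
    (e : ι ≃ Fin T) (v : ι → (ι → ℤˣ) → X),
    (∀ t ε ε', (∀ s, e s < e t → ε s = ε' s) → v t ε = v t ε') →
    𝔼 δ, ‖radSum (fun t => (Fintype.card (ι → ℤˣ) : ℝ)⁻¹ • ∑ ε, v t ε) δ‖ ^ 2 ≤
      β * 𝔼 ε, ‖radSum (fun t => v t ε) ε‖ ^ 2 := by
  obtain ⟨β, hβ, h⟩ := hX.lintegral_le (p := 2) (by norm_num)
  refine ⟨β, hβ, fun {ι} _ _ {T} e v hv => ?_⟩
  have h1 : ∀ δ : ι → ℤˣ, 𝔼 ε, ‖radSum (fun t => v t ε) (δ * ε)‖ ^ 2 ≤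
      β * 𝔼 ε, ‖radSum (fun t => v t ε) ε‖ ^ 2 := by
    intro δ
    letI : MeasurableSpace (ι → ℤˣ) := ⊤
    have hP : IsProbabilityMeasure (uniformOn (Set.univ : Set (ι → ℤˣ))) :=
      isProbabilityMeasure_uniformOn Set.finite_univ Set.univ_nonempty
    have h2 := h _ _ _ hP _ _ (isMartDiffSeq_signDiff e hv)
      (fun j => if h : j < T then signVal (δ (e.symm ⟨j, h⟩)) else 1)
      (fun j => by
        split_ifs
        · exact signVal_eq _
        · simp) T
    have h3 : ∀ ε, ∑ j ∈ Finset.range T, signDiff e v j ε = radSum (fun t => v t ε) ε := fun ε => by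
      have := sum_signDiff e v 1 ε
      simpa [radSum] using this
    simp only [sum_signDiff, h3] at h2
    have h4 : ∀ y : X, ‖y‖ₑ ^ (2 : ℝ) = ENNReal.ofReal (‖y‖ ^ 2) := fun y => by
      rw [← ofReal_norm, ENNReal.ofReal_rpow_of_nonneg (norm_nonneg _) (by norm_num)]
      simp
    simp only [h4] at h2
    rw [lintegral_uniformOn_univ _ (fun _ => by positivity),
      lintegral_uniformOn_univ _ (fun _ => by positivity), ← ENNReal.ofReal_mul hβ.le,
      ENNReal.ofReal_le_ofReal_iff (mul_nonneg hβ.le (expect_nonneg' fun _ => by positivity))] at h2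
    simpa [radSum, signVal_mul, smul_smul] using h2
  calc _ ≤ 𝔼 δ, 𝔼 ε, ‖radSum (fun t => v t ε) δ‖ ^ 2 := by
        refine expect_mono fun δ => ?_
        refine le_trans (le_of_eq ?_) (norm_smul_sum_sq_le _)
        congr 2
        simp only [radSum, Finset.smul_sum]
        rw [Finset.sum_comm]
        exact Finset.sum_congr rfl fun _ _ => Finset.sum_congr rfl fun _ _ => smul_comm _ _ _
    _ = 𝔼 ε, 𝔼 δ, ‖radSum (fun t => v t ε) δ‖ ^ 2 := Finset.expect_comm _ _ _
    _ = 𝔼 ε, 𝔼 δ, ‖radSum (fun t => v t ε) (δ * ε)‖ ^ 2 := by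
        refine Finset.expect_congr rfl fun ε _ => ?_
        rw [← expect_mul_left ε]
        simp only [mul_comm]
    _ = 𝔼 δ, 𝔼 ε, ‖radSum (fun t => v t ε) (δ * ε)‖ ^ 2 := Finset.expect_comm _ _ _
    _ ≤ 𝔼 δ : ι → ℤˣ, β * 𝔼 ε, ‖radSum (fun t => v t ε) ε‖ ^ 2 := expect_mono h1
    _ = _ := Fintype.expect_const _

end SignFiltration

/-! ### Comparison of Gaussian and Rademacher sums in UMD spaces -/

section Riesz

open scoped BigOperators

/-- The `j`-th factor of a Riesz product. -/
def rieszFactor {K : ℕ} (a : ℝ) (r : Fin K → ℤˣ) (j : ℕ) : ℂ :=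
  ⟨1, a * if h : j < K then signVal (r ⟨j, h⟩) else 0⟩

/-- The Riesz product `∏_{j<k} (1 + i a rⱼ)`. -/
def rieszProd {K : ℕ} (a : ℝ) (r : Fin K → ℤˣ) (k : ℕ) : ℂ :=
  ∏ j ∈ Finset.range k, rieszFactor a r j

variable {K : ℕ} {a : ℝ}

lemma rieszProd_succ (r : Fin K → ℤˣ) (k : ℕ) :
    rieszProd a r (k + 1) = rieszProd a r k * rieszFactor a r k :=
  Finset.prod_range_succ _ _

lemma rieszProd_congr {r r' : Fin K → ℤˣ} {k : ℕ} (h : ∀ j : Fin K, (j : ℕ) < k → r j = r' j) :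
    rieszProd a r k = rieszProd a r' k := by
  refine Finset.prod_congr rfl fun j hj => ?_
  simp only [rieszFactor]
  congr 2
  split_ifs with hK
  · rw [h ⟨j, hK⟩ (Finset.mem_range.1 hj)]
  · rfl

lemma rieszProd_neg (r : Fin K → ℤˣ) (k : ℕ) :
    rieszProd a (-r) k = star (rieszProd a r k) := by
  rw [rieszProd, rieszProd, star_prod]
  refine Finset.prod_congr rfl fun j _ => ?_
  simp only [rieszFactor]
  apply Complex.ext <;> simp
  split_ifs <;> simp

lemma sum_re_rieszProd (r : Fin K → ℤˣ) :
    ∑ k : Fin K, a * signVal (r k) * (rieszProd a r k).re = (rieszProd a r K).im := by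
  have : ∀ k ≤ K, ∑ j ∈ Finset.range k, (a * if h : j < K then signVal (r ⟨j, h⟩) else 0) *
      (rieszProd a r j).re = (rieszProd a r k).im := by
    intro k
    induction k with
    | zero => simp [rieszProd]
    | succ k ih =>
      intro hk
      rw [Finset.sum_range_succ, ih (by omega), rieszProd_succ, Complex.mul_im]
      simp only [rieszFactor]
      ring
  rw [← this K le_rfl, Finset.sum_range]
  simp

lemma sq_im_rieszProd_le (ha : a ^ 2 * K ≤ 1) (r : Fin K → ℤˣ) :
    (rieszProd a r K).im ^ 2 ≤ Real.exp 1 := by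
  have h1 : (rieszProd a r K).im ^ 2 ≤ Complex.normSq (rieszProd a r K) := by
    rw [Complex.normSq_apply]
    nlinarith [mul_self_nonneg (rieszProd a r K).re]
  refine h1.trans ?_
  rw [rieszProd, map_prod]
  calc ∏ j ∈ Finset.range K, Complex.normSq (rieszFactor a r j)
      ≤ ∏ j ∈ Finset.range K, Real.exp (a ^ 2) := by
        refine Finset.prod_le_prod (fun _ _ => Complex.normSq_nonneg _) fun j hj => ?_
        have : Complex.normSq (rieszFactor a r j) = a ^ 2 + 1 := by
          rw [Complex.normSq_apply, rieszFactor]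
          simp only [Finset.mem_range.1 hj, dif_pos]
          rw [mul_mul_mul_comm, signVal_mul_self]
          ring
        rw [this]
        exact Real.add_one_le_exp _
    _ = Real.exp (a ^ 2 * K) := by
        rw [Finset.prod_const, Finset.card_range, ← Real.exp_nat_mul, mul_comm]
    _ ≤ _ := Real.exp_le_exp.2 ha

lemma avg_rieszProd {N : ℕ} (n : Fin N) (k : ℕ) (hk : k ≤ K) :
    ∑ ε : Fin N × Fin K → ℤˣ, rieszProd a (fun j => ε (n, j)) k =
      Fintype.card (Fin N × Fin K → ℤˣ) := by
  induction k with
  | zero => simp [rieszProd]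
  | succ k ih =>
    rw [← ih (by omega)]
    let σ : (Fin N × Fin K → ℤˣ) ≃ (Fin N × Fin K → ℤˣ) :=
      Equiv.mulLeft (Pi.mulSingle (n, ⟨k, hk⟩) (-1))
    have h1 : ∀ ε, rieszProd a (fun j => ε (n, j)) (k + 1) +
        rieszProd a (fun j => σ ε (n, j)) (k + 1) = 2 * rieszProd a (fun j => ε (n, j)) k := by
      intro ε
      have h2 : rieszProd a (fun j => σ ε (n, j)) k = rieszProd a (fun j => ε (n, j)) k := by
        refine rieszProd_congr fun j hj => ?_
        have : (n, j) ≠ (n, ⟨k, hk⟩) := by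
          intro h
          simp only [Prod.mk.injEq, true_and] at h
          rw [h] at hj
          exact lt_irrefl _ hj
        simp [σ, this]
      have h3 : σ ε (n, ⟨k, hk⟩) = -ε (n, ⟨k, hk⟩) := by simp [σ]
      rw [rieszProd_succ, rieszProd_succ, h2, ← mul_add, mul_comm]
      congr 1
      have hk' : k < K := hk
      apply Complex.ext <;> simp [rieszFactor, hk', h3]
      norm_num
    have h4 : ∑ ε, rieszProd a (fun j => σ ε (n, j)) (k + 1) =
        ∑ ε : Fin N × Fin K → ℤˣ, rieszProd a (fun j => ε (n, j)) (k + 1) :=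
      Equiv.sum_comp σ fun ε => rieszProd a (fun j => ε (n, j)) (k + 1)
    have h5 := Finset.sum_congr rfl fun ε (_ : ε ∈ Finset.univ) => h1 ε
    rw [Finset.sum_add_distrib, h4, ← two_mul, ← Finset.mul_sum] at h5
    exact mul_left_cancel₀ two_ne_zero h5

variable {X : Type*} [NormedAddCommGroup X] [NormedSpace ℝ X]

lemma expect_im_rieszProd_le {N : ℕ} (ha : a ^ 2 * K ≤ 1) (x : Fin N → X) :
    𝔼 ε : Fin N × Fin K → ℤˣ, ‖∑ n, (rieszProd a (fun j => ε (n, j)) K).im • x n‖ ^ 2 ≤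
      Real.exp 1 * 𝔼 ε, ‖radSum x ε‖ ^ 2 := by
  have h1 : ∀ θ : Fin N → ℤˣ,
      𝔼 ε : Fin N × Fin K → ℤˣ, ‖∑ n, (rieszProd a (fun j => ε (n, j)) K).im • x n‖ ^ 2 =
      𝔼 ε : Fin N × Fin K → ℤˣ,
        ‖radSum (fun n => (rieszProd a (fun j => ε (n, j)) K).im • x n) θ‖ ^ 2 := by
    intro θ
    rw [← expect_mul_left (fun q : Fin N × Fin K => θ q.1)]
    refine Finset.expect_congr rfl fun ε _ => ?_
    congr 2
    refine Finset.sum_congr rfl fun n _ => ?_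
    rw [smul_smul]
    congr 1
    have : (fun j => ((fun q : Fin N × Fin K => θ q.1) * ε) (n, j)) =
        fun j => θ n * ε (n, j) := rfl
    rw [this]
    rcases Int.units_eq_one_or (θ n) with h | h
    · simp [h]
    · have : (fun j => θ n * ε (n, j)) = -fun j => ε (n, j) := by ext j; simp [h]
      rw [this, rieszProd_neg, h]
      simp
  have hs : Real.sqrt (Real.exp 1) ^ 2 = Real.exp 1 := Real.sq_sqrt (Real.exp_pos _).le
  calc _ = 𝔼 θ : Fin N → ℤˣ, 𝔼 ε : Fin N × Fin K → ℤˣ,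
        ‖radSum (fun n => (rieszProd a (fun j => ε (n, j)) K).im • x n) θ‖ ^ 2 := by
        rw [← Finset.expect_congr rfl fun θ _ => h1 θ, Fintype.expect_const]
    _ = 𝔼 ε : Fin N × Fin K → ℤˣ, 𝔼 θ : Fin N → ℤˣ,
        ‖radSum (fun n => (rieszProd a (fun j => ε (n, j)) K).im • x n) θ‖ ^ 2 :=
        Finset.expect_comm _ _ _
    _ ≤ 𝔼 ε : Fin N × Fin K → ℤˣ, Real.exp 1 * 𝔼 ε, ‖radSum x ε‖ ^ 2 := by
        refine expect_mono fun ε => ?_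
        rw [← hs]
        refine expect_radSum_contraction x _ fun n => ?_
        exact Real.abs_le_sqrt (sq_im_rieszProd_le ha _)
    _ = _ := Fintype.expect_const _

/-- In a UMD space, normalised block sums of signs are dominated by Rademacher sums. -/
lemma umd_block_sums [CompleteSpace X] (hX : IsUMD X) : ∃ C : ℝ, 0 < C ∧ ∀ (N K : ℕ)
    (x : Fin N → X), 𝔼 δ : Fin N × Fin K → ℤˣ,
      ‖∑ n, ((√(K : ℝ))⁻¹ * ∑ k, signVal (δ (n, k))) • x n‖ ^ 2 ≤ C * 𝔼 ε, ‖radSum x ε‖ ^ 2 := by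
  obtain ⟨β, hβ, h⟩ := umd_signs hX
  refine ⟨β * Real.exp 1, by positivity, fun N K x => ?_⟩
  set a : ℝ := (√(K : ℝ))⁻¹ with ha
  have haK : a ^ 2 * K ≤ 1 := by
    rw [ha, inv_pow, Real.sq_sqrt (Nat.cast_nonneg K)]
    exact inv_mul_le_one
  have h1 := h finProdFinEquiv
    (fun (t : Fin N × Fin K) ε => (a * (rieszProd a (fun j => ε (t.1, j)) t.2).re) • x t.1)
    (fun t ε ε' hε => by
      have : rieszProd a (fun j => ε (t.1, j)) t.2 = rieszProd a (fun j => ε' (t.1, j)) t.2 := by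
        refine rieszProd_congr fun j hj => hε _ ?_
        rw [Fin.lt_def]
        simpa [finProdFinEquiv] using hj
      simp only [this])
  have h2 : ∀ t : Fin N × Fin K, (Fintype.card (Fin N × Fin K → ℤˣ) : ℝ)⁻¹ •
      ∑ ε : Fin N × Fin K → ℤˣ, (a * (rieszProd a (fun j => ε (t.1, j)) t.2).re) • x t.1 =
      a • x t.1 := by
    intro t
    have h3 := congrArg Complex.re (avg_rieszProd (a := a) t.1 t.2 t.2.is_lt.le)
    rw [Complex.re_sum, Complex.natCast_re] at h3
    rw [← Finset.sum_smul, ← Finset.mul_sum, h3, smul_smul]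
    congr 1
    rw [mul_comm a, ← mul_assoc, inv_mul_cancel₀ (by exact_mod_cast Fintype.card_ne_zero), one_mul]
  have h4 : ∀ δ : Fin N × Fin K → ℤˣ, radSum (fun t : Fin N × Fin K => a • x t.1) δ =
      ∑ n, (a * ∑ k, signVal (δ (n, k))) • x n := by
    intro δ
    rw [radSum, Fintype.sum_prod_type]
    refine Finset.sum_congr rfl fun n _ => ?_
    simp only [smul_smul, ← Finset.sum_smul, ← Finset.sum_mul]
    rw [mul_comm]
  have h5 : ∀ ε : Fin N × Fin K → ℤˣ, radSum (fun t : Fin N × Fin K =>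
      (a * (rieszProd a (fun j => ε (t.1, j)) t.2).re) • x t.1) ε =
      ∑ n, (rieszProd a (fun j => ε (n, j)) K).im • x n := by
    intro ε
    rw [radSum, Fintype.sum_prod_type]
    refine Finset.sum_congr rfl fun n _ => ?_
    simp only [smul_smul, ← Finset.sum_smul]
    rw [← sum_re_rieszProd]
    congr 1
    refine Finset.sum_congr rfl fun k _ => ?_
    ring
  simp only [h2, h4, h5] at h1
  refine h1.trans ?_
  rw [mul_assoc]
  gcongr
  exact expect_im_rieszProd_le haK x

end Riesz

/-! ### Passage from block sums of signs to Gaussian sums -/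

section CentralLimit

open scoped BigOperators

instance measurableSingletonClass_intUnits : MeasurableSingletonClass ℤˣ where
  measurableSet_singleton u := ⟨{(u : ℤ)}, measurableSet_singleton _, by
    ext v; simp [Units.ext_iff]⟩

lemma uniformOn_univ_pi {ι α : Type*} [Fintype ι] [Fintype α] [Nonempty α]
    [MeasurableSpace α] [MeasurableSingletonClass α] :
    (uniformOn Set.univ : Measure (ι → α)) = Measure.pi fun _ => uniformOn Set.univ := by
  have : IsProbabilityMeasure (uniformOn Set.univ : Measure α) :=
    isProbabilityMeasure_uniformOn Set.finite_univ Set.univ_nonempty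
  refine Measure.ext_of_singleton fun f => ?_
  rw [Measure.pi_singleton]
  simp [uniformOn_univ, ENNReal.inv_pow]

/-- The normalised sum of signs. -/
def normSignSum (K : ℕ) (r : Fin K → ℤˣ) : ℝ := (√(K : ℝ))⁻¹ * ∑ k, signVal (r k)

/-- The law of the normalised sum of `K` independent signs. -/
def signSumLaw (K : ℕ) : ProbabilityMeasure ℝ :=
  ⟨(uniformOn Set.univ : Measure (Fin K → ℤˣ)).map (normSignSum K), by
    have : IsProbabilityMeasure (uniformOn Set.univ : Measure (Fin K → ℤˣ)) :=
      isProbabilityMeasure_uniformOn Set.finite_univ Set.univ_nonempty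
    exact Measure.isProbabilityMeasure_map Measurable.of_discrete.aemeasurable⟩

lemma charFun_signSumLaw (K : ℕ) (t : ℝ) : charFun (signSumLaw K : Measure ℝ) t =
    charFun ((uniformOn Set.univ : Measure ℤˣ).map signVal) ((√(K : ℝ))⁻¹ * t) ^ K := by
  have h1 : (signSumLaw K : Measure ℝ) =
    (uniformOn Set.univ : Measure (Fin K → ℤˣ)).map (normSignSum K) := rfl
  rw [h1, charFun_apply_real, charFun_apply_real,
    integral_map Measurable.of_discrete.aemeasurable (by fun_prop),
    integral_map Measurable.of_discrete.aemeasurable (by fun_prop),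
    integral_uniformOn_univ, integral_uniformOn_univ]
  have h2 : ∀ r : Fin K → ℤˣ, Complex.exp (t * (normSignSum K r : ℝ) * Complex.I) =
      ∏ k, Complex.exp (((√(K : ℝ))⁻¹ * t : ℝ) * signVal (r k) * Complex.I) := by
    intro r
    rw [← Complex.exp_sum, normSignSum]
    congr 1
    push_cast
    rw [Finset.mul_sum, Finset.mul_sum, Finset.sum_mul]
    refine Finset.sum_congr rfl fun k _ => ?_
    ring
  simp only [h2]
  rw [smul_pow, Fintype.sum_pow]
  simp

/-- The standard Gaussian law on the real line. -/
def stdGaussianLaw : ProbabilityMeasure ℝ := ⟨gaussianReal 0 1, inferInstance⟩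

lemma tendsto_signSumLaw : Tendsto signSumLaw atTop (𝓝 stdGaussianLaw) := by
  rw [ProbabilityMeasure.tendsto_iff_tendsto_charFun]
  intro t
  have : IsProbabilityMeasure (uniformOn Set.univ : Measure ℤˣ) :=
    isProbabilityMeasure_uniformOn Set.finite_univ Set.univ_nonempty
  simp only [charFun_signSumLaw]
  have h := tendsto_charFun_inv_sqrt_mul_pow (P := (uniformOn Set.univ : Measure ℤˣ))
    (X := signVal) Measurable.of_discrete.aemeasurable
    (by rw [integral_uniformOn_univ]; simp [UnitsInt.univ])
    (by rw [integral_uniformOn_univ]; simp [UnitsInt.univ]; norm_num) t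
  have h2 : charFun (stdGaussianLaw : Measure ℝ) t =
      Complex.exp (-t ^ 2 / 2) := by
    rw [stdGaussianLaw, ProbabilityMeasure.coe_mk, charFun_gaussianReal]
    simp [neg_div]
  rw [h2]
  exact h

variable {X : Type*} [NormedAddCommGroup X] [NormedSpace ℝ X]

lemma enorm_sq_eq_ofReal (y : X) : ‖y‖ₑ ^ 2 = ENNReal.ofReal (‖y‖ ^ 2) := by
  rw [← ofReal_norm, ENNReal.ofReal_pow (norm_nonneg _)]

lemma continuous_sum_smul {N : ℕ} (x : Fin N → X) :
    Continuous fun g : Fin N → ℝ => ∑ i, g i • x i := by fun_prop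

lemma lintegral_pi_signSumLaw {N K : ℕ} (x : Fin N → X) :
    ∫⁻ g, ENNReal.ofReal (‖∑ i, g i • x i‖ ^ 2)
      ∂(ProbabilityMeasure.pi (fun _ : Fin N => signSumLaw K) : Measure (Fin N → ℝ)) =
    ENNReal.ofReal (𝔼 δ : Fin N × Fin K → ℤˣ,
      ‖∑ n, ((√(K : ℝ))⁻¹ * ∑ k, signVal (δ (n, k))) • x n‖ ^ 2) := by
  have : IsProbabilityMeasure (uniformOn Set.univ : Measure (Fin K → ℤˣ)) :=
    isProbabilityMeasure_uniformOn Set.finite_univ Set.univ_nonempty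
  have h1 : (ProbabilityMeasure.pi (fun _ : Fin N => signSumLaw K) : Measure (Fin N → ℝ)) =
      (uniformOn Set.univ : Measure (Fin N → Fin K → ℤˣ)).map
        fun r n => normSignSum K (r n) := by
    have : IsProbabilityMeasure
        ((uniformOn Set.univ : Measure (Fin K → ℤˣ)).map (normSignSum K)) :=
      Measure.isProbabilityMeasure_map Measurable.of_discrete.aemeasurable
    rw [uniformOn_univ_pi, Measure.pi_map_pi fun _ => Measurable.of_discrete.aemeasurable]
    rfl
  have hm : Measurable fun g : Fin N → ℝ => ENNReal.ofReal (‖∑ i, g i • x i‖ ^ 2) :=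
    ((continuous_sum_smul x).norm.pow 2).measurable.ennreal_ofReal
  rw [h1, lintegral_map hm Measurable.of_discrete,
    lintegral_uniformOn_univ _ (fun _ => by positivity)]
  congr 1
  exact (Fintype.expect_equiv (Equiv.curry (Fin N) (Fin K) ℤˣ) _ _ fun δ => rfl).symm

/-- In a UMD space, Gaussian sums are dominated by Rademacher sums. -/
lemma umd_gaussian_le_radSum [CompleteSpace X] (hX : IsUMD X) : ∃ C : ℝ, 0 < C ∧
    ∀ (N : ℕ) (x : Fin N → X), ∫⁻ g, ‖∑ i, g i • x i‖ₑ ^ 2 ∂gaussianPi N ≤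
      ENNReal.ofReal (C * 𝔼 ε, ‖radSum x ε‖ ^ 2) := by
  obtain ⟨C, hC, h⟩ := umd_block_sums hX
  refine ⟨C, hC, fun N x => ?_⟩
  have h1 : Tendsto (fun K => ProbabilityMeasure.pi fun _ : Fin N => signSumLaw K) atTop
      (𝓝 (ProbabilityMeasure.pi fun _ : Fin N => stdGaussianLaw)) :=
    (ProbabilityMeasure.continuous_pi.tendsto _).comp
      (tendsto_pi_nhds.2 fun _ => tendsto_signSumLaw)
  have hc := continuous_sum_smul x
  have h2 := lintegral_le_liminf_lintegral_of_forall_isOpen_measure_le_liminf_measure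
    (f := fun g : Fin N → ℝ => ‖∑ i, g i • x i‖ ^ 2) (by fun_prop) (fun _ => by positivity)
    fun G hG => ProbabilityMeasure.le_liminf_measure_open_of_tendsto h1 hG
  simp only [lintegral_pi_signSumLaw] at h2
  simp only [enorm_sq_eq_ofReal]
  refine h2.trans ?_
  refine (liminf_le_liminf (.of_forall fun K => ENNReal.ofReal_le_ofReal (h N K x))).trans ?_
  rw [liminf_const]

end CentralLimit

/-! ### Gaussian sums -/

section Gaussian

open scoped BigOperators

/-- The law of a sequence of independent standard Gaussian random variables. -/
def gaussSeq : Measure (ℕ → ℝ) := Measure.infinitePi fun _ => gaussianReal 0 1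

instance : IsProbabilityMeasure gaussSeq := by unfold gaussSeq; infer_instance

lemma map_gaussSeq (n : ℕ) : gaussSeq.map (fun g (i : Fin n) => g i) = gaussianPi n := by
  rw [gaussSeq, Measure.map_infinitePi_infinitePi_of_inj Fin.val_injective,
    Measure.infinitePi_eq_pi, gaussianPi]

lemma map_sign_gaussSeq (δ : ℕ → ℤˣ) :
    gaussSeq.map (fun g i => signVal (δ i) * g i) = gaussSeq := by
  have h : ∀ i, (gaussianReal 0 1).map (fun y => signVal (δ i) * y) = gaussianReal 0 1 := by
    intro i
    rw [gaussianReal_map_const_mul]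
    congr 1
    · simp
    · ext; simp [sq]
  rw [gaussSeq, Measure.infinitePi_map_pi (f := fun i y => signVal (δ i) * y) _
    fun i => measurable_const_mul _]
  simp only [h]

lemma map_eval_gaussSeq (i : ℕ) : gaussSeq.map (fun g => g i) = gaussianReal 0 1 :=
  Measure.infinitePi_map_eval _ i

variable {X : Type*} [NormedAddCommGroup X] [NormedSpace ℝ X]

/-- The `L²`-norm of the Gaussian sum with coefficients `x 0, …, x (n - 1)`. -/
def gaussPath (n : ℕ) (x : ℕ → X) : ℝ≥0∞ :=
  eLpNorm (fun g : ℕ → ℝ => ∑ i ∈ Finset.range n, g i • x i) 2 gaussSeq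

lemma stronglyMeasurable_gaussSum (n : ℕ) (x : ℕ → X) :
    StronglyMeasurable fun g : ℕ → ℝ => ∑ i ∈ Finset.range n, g i • x i :=
  Finset.stronglyMeasurable_fun_sum _ fun i _ =>
    (measurable_pi_apply i).stronglyMeasurable.smul_const _

lemma eLpNorm_two_sq {α : Type*} {mα : MeasurableSpace α} (μ : Measure α) (f : α → X) :
    eLpNorm f 2 μ ^ 2 = ∫⁻ a, ‖f a‖ₑ ^ 2 ∂μ := by
  rw [eLpNorm_eq_lintegral_rpow_enorm_toReal (by norm_num) (by norm_num), ← ENNReal.rpow_natCast,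
    ← ENNReal.rpow_mul]
  simp

lemma gaussPath_sq (n : ℕ) (x : ℕ → X) :
    gaussPath n x ^ 2 = ∫⁻ g, ‖∑ i : Fin n, g i • x i‖ₑ ^ 2 ∂gaussianPi n := by
  have hm : Measurable fun g : Fin n → ℝ => ‖∑ i, g i • x i‖ₑ ^ 2 :=
    (continuous_sum_smul fun i : Fin n => x i).enorm.measurable.pow_const 2
  rw [gaussPath, eLpNorm_two_sq, ← map_gaussSeq, lintegral_map hm (by fun_prop)]
  simp only [Finset.sum_range]

lemma gammaSeqNorm_eq_iSup (x : ℕ → X) : gammaSeqNorm x = ⨆ n, gaussPath n x := by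
  refine iSup_congr fun n => ?_
  rw [← ENNReal.rpow_left_injective (x := 2) (by norm_num) |>.eq_iff]
  simp only [ENNReal.rpow_ofNat]
  rw [gaussPath_sq, ← ENNReal.rpow_natCast, ← ENNReal.rpow_mul]
  simp [enorm]

lemma gaussPath_add_le (n : ℕ) (x y : ℕ → X) :
    gaussPath n (x + y) ≤ gaussPath n x + gaussPath n y := by
  have h := eLpNorm_add_le (p := 2) (stronglyMeasurable_gaussSum n x).aestronglyMeasurable
    (stronglyMeasurable_gaussSum n y).aestronglyMeasurable (μ := gaussSeq) (by norm_num)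
  have e : (fun g : ℕ → ℝ => ∑ i ∈ Finset.range n, g i • (x + y) i) =
      (fun g : ℕ → ℝ => ∑ i ∈ Finset.range n, g i • x i) +
        fun g : ℕ → ℝ => ∑ i ∈ Finset.range n, g i • y i := by
    ext g
    simp [smul_add, Finset.sum_add_distrib]
  rw [gaussPath, e]
  exact h

/-- Changing the signs of the coefficients does not change the norm of a Gaussian sum. -/
lemma gaussPath_sign (n : ℕ) (x : ℕ → X) (δ : ℕ → ℤˣ) :
    eLpNorm (fun g : ℕ → ℝ => ∑ i ∈ Finset.range n, g i • signVal (δ i) • x i) 2 gaussSeq =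
      gaussPath n x := by
  conv_rhs => rw [gaussPath, ← map_sign_gaussSeq δ]
  rw [eLpNorm_map_measure (stronglyMeasurable_gaussSum n x).aestronglyMeasurable
    (measurable_pi_lambda _ fun i => (measurable_pi_apply i).const_mul _).aemeasurable]
  congr 1
  ext g
  simp [smul_smul, mul_comm]

lemma eLpNorm_gauss_smul (k : ℕ) (y : X) :
    eLpNorm (fun g : ℕ → ℝ => g k • y) 2 gaussSeq = ‖y‖ₑ := by
  have h1 : eLpNorm (fun g : ℕ → ℝ => g k) 2 gaussSeq = 1 := by
    have h2 : eLpNorm (id : ℝ → ℝ) 2 (gaussianReal 0 1) = 1 := by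
      have h3 : eLpNorm (id : ℝ → ℝ) 2 (gaussianReal 0 1) ^ 2 = 1 := by
        rw [eLpNorm_two_sq]
        have h4 := variance_id_gaussianReal (μ := 0) (v := 1)
        rw [variance_of_integral_eq_zero aemeasurable_id (by simp)] at h4
        have h5 : ∀ a : ℝ, ‖(id a : ℝ)‖ₑ ^ 2 = ENNReal.ofReal (a ^ 2) := fun a => by
          rw [enorm_sq_eq_ofReal]; simp
        simp only [h5]
        rw [← ofReal_integral_eq_lintegral_ofReal]
        · simpa using h4
        · exact (memLp_id_gaussianReal 2).integrable_sq
        · exact .of_forall fun a => sq_nonneg a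
      rw [← ENNReal.rpow_left_injective (x := 2) (by norm_num) |>.eq_iff]
      simpa using h3
    rw [← map_eval_gaussSeq k] at h2
    exact (eLpNorm_map_measure aestronglyMeasurable_id
      (measurable_pi_apply k).aemeasurable).symm.trans h2
  have h2 : (fun g : ℕ → ℝ => g k • y) = fun g : ℕ → ℝ => ‖y‖ • g k • (‖y‖⁻¹ • y) := by
    ext g
    rcases eq_or_ne y 0 with rfl | hy
    · simp
    · rw [smul_comm (g k), smul_smul, mul_inv_cancel₀ (norm_ne_zero_iff.2 hy), one_smul]
  have h3 : eLpNorm (fun g : ℕ → ℝ => g k • y) 2 gaussSeq =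
      eLpNorm (fun g : ℕ → ℝ => g k * ‖y‖) 2 gaussSeq := by
    refine eLpNorm_congr_norm_ae (.of_forall fun g => ?_)
    simp [norm_smul]
  rw [h3]
  have := eLpNorm_const_smul (‖y‖) (fun g : ℕ → ℝ => g k) 2 gaussSeq
  rw [h1, mul_one] at this
  rw [← enorm_norm, ← this]
  congr 1
  ext g
  simp [mul_comm]

lemma gaussPath_succ_le (n : ℕ) (x : ℕ → X) :
    gaussPath (n + 1) x ≤ gaussPath n x + ‖x n‖ₑ := by
  rw [← eLpNorm_gauss_smul n]
  have h := eLpNorm_add_le (p := 2) (stronglyMeasurable_gaussSum n x).aestronglyMeasurable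
    (((measurable_pi_apply n).stronglyMeasurable.smul_const (x n)).aestronglyMeasurable)
    (μ := gaussSeq) (by norm_num)
  refine le_trans (le_of_eq ?_) h
  rw [gaussPath]
  congr 1
  ext g
  simp [Finset.sum_range_succ]

/-- The Gaussian sum with the sign of the last summand changed. -/
lemma gaussPath_flip_last (n : ℕ) (x : ℕ → X) :
    eLpNorm (fun g : ℕ → ℝ => (∑ i ∈ Finset.range n, g i • x i) - g n • x n) 2 gaussSeq =
      gaussPath (n + 1) x := by
  rw [← gaussPath_sign (n + 1) x (Function.update 1 n (-1))]
  congr 1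
  ext g
  rw [Finset.sum_range_succ, sub_eq_add_neg]
  congr 1
  · refine Finset.sum_congr rfl fun i hi => ?_
    rw [Function.update_of_ne (Finset.mem_range.1 hi).ne]
    simp
  · simp

lemma two_mul_le_gaussPath {n : ℕ} {x : ℕ → X} {f : (ℕ → ℝ) → X} {s : ℝ} (hs : |s| = 1)
    (hf : ∀ g, f g = (2⁻¹ : ℝ) • (∑ i ∈ Finset.range (n + 1), g i • x i) +
      (s * 2⁻¹) • ((∑ i ∈ Finset.range n, g i • x i) - g n • x n)) :
    eLpNorm f 2 gaussSeq ≤ gaussPath (n + 1) x := by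
  have hm := (stronglyMeasurable_gaussSum (n + 1) x)
  have hm' := (stronglyMeasurable_gaussSum n x).sub
    ((measurable_pi_apply n).stronglyMeasurable.smul_const (x n))
  have h := eLpNorm_add_le (p := 2) (hm.const_smul (2⁻¹ : ℝ)).aestronglyMeasurable
    (hm'.const_smul (s * 2⁻¹)).aestronglyMeasurable (μ := gaussSeq) (by norm_num)
  rw [eLpNorm_const_smul, eLpNorm_const_smul] at h
  have e1 : ‖(2⁻¹ : ℝ)‖ₑ = 2⁻¹ := by
    rw [Real.enorm_eq_ofReal (by norm_num), ENNReal.ofReal_inv_of_pos (by norm_num)]; simp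
  have e2 : ‖s * 2⁻¹‖ₑ = 2⁻¹ := by
    rw [enorm_mul, e1, ← ofReal_norm, Real.norm_eq_abs, hs]; simp
  rw [e1, e2] at h
  have e3 : f = ((2⁻¹ : ℝ) • fun g : ℕ → ℝ => ∑ i ∈ Finset.range (n + 1), g i • x i) +
      (s * 2⁻¹) • ((fun g : ℕ → ℝ => ∑ i ∈ Finset.range n, g i • x i) -
        fun g : ℕ → ℝ => g n • x n) := by
    ext g; rw [hf]; rfl
  rw [e3]
  refine h.trans (le_of_eq ?_)
  have e4 := gaussPath_flip_last n x
  change 2⁻¹ * gaussPath (n + 1) x + 2⁻¹ * eLpNorm (fun g : ℕ → ℝ =>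
    (∑ i ∈ Finset.range n, g i • x i) - g n • x n) 2 gaussSeq = _
  rw [e4, ← add_mul, ENNReal.inv_two_add_inv_two, one_mul]

lemma gaussPath_le_succ (n : ℕ) (x : ℕ → X) : gaussPath n x ≤ gaussPath (n + 1) x := by
  refine two_mul_le_gaussPath (s := 1) (by simp) fun g => ?_
  rw [Finset.sum_range_succ]
  module

lemma enorm_le_gaussPath_succ (n : ℕ) (x : ℕ → X) : ‖x n‖ₑ ≤ gaussPath (n + 1) x := by
  rw [← eLpNorm_gauss_smul n]
  refine two_mul_le_gaussPath (s := -1) (by simp) fun g => ?_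
  rw [Finset.sum_range_succ]
  module

lemma measurable_gaussPath {Ω : Type*} {m : MeasurableSpace Ω} {n : ℕ} {d : ℕ → Ω → X}
    (hd : ∀ k < n, StronglyMeasurable (d k)) :
    Measurable fun ω => gaussPath n fun k => d k ω := by
  have h : ∀ ω, gaussPath n (fun k => d k ω) =
      (∫⁻ g, ‖∑ i ∈ Finset.range n, g i • d i ω‖ₑ ^ 2 ∂gaussSeq) ^ (1 / 2 : ℝ) := fun ω => by
    rw [gaussPath, ← eLpNorm_two_sq, ← ENNReal.rpow_natCast, ← ENNReal.rpow_mul]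
    simp
  simp only [h]
  refine Measurable.pow_const ?_ _
  refine Measurable.lintegral_prod_right' (ν := gaussSeq)
    (f := fun q : Ω × (ℕ → ℝ) => ‖∑ i ∈ Finset.range n, q.2 i • d i q.1‖ₑ ^ 2) ?_
  refine Measurable.pow_const (StronglyMeasurable.enorm ?_) _
  refine Finset.stronglyMeasurable_fun_sum _ fun i hi => ?_
  exact ((measurable_pi_apply i).comp measurable_snd).stronglyMeasurable.smul
    ((hd i (Finset.mem_range.1 hi)).comp_measurable measurable_fst)

/-- The first absolute moment of a standard Gaussian. -/
def gaussAbs : ℝ := ∫ y, |y| ∂gaussianReal 0 1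

lemma gaussAbs_pos : 0 < gaussAbs := by
  have hi : Integrable (fun y : ℝ => |y|) (gaussianReal 0 1) :=
    ((memLp_id_gaussianReal 1).integrable le_rfl).abs
  refine (integral_nonneg fun _ => abs_nonneg _).lt_of_ne fun h => ?_
  have h1 := (integral_eq_zero_iff_of_nonneg (fun _ => abs_nonneg _) hi).1 h.symm
  have h2 : ∀ᵐ y ∂gaussianReal 0 1, y = (0 : ℝ) := by
    filter_upwards [h1] with y hy
    simpa using hy
  have := nullSingletonClass_gaussianReal (μ := 0) (v := 1) (by norm_num)
  have h3 : ∀ᵐ y ∂gaussianReal 0 1, y ≠ (0 : ℝ) := by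
    rw [ae_iff]; simp
  have h4 : ∀ᵐ _ ∂gaussianReal 0 1, False := by
    filter_upwards [h2, h3] with y h2 h3 using h3 h2
  have h5 := h4.exists
  simp at h5

variable [CompleteSpace X]

/-- Rademacher sums are dominated by Gaussian sums. -/
lemma radSum_le_gaussPath (n : ℕ) (x : ℕ → X) :
    ENNReal.ofReal (gaussAbs ^ 2 * 𝔼 ε, ‖radSum (fun i : Fin n => x i) ε‖ ^ 2) ≤
      gaussPath n x ^ 2 := by
  obtain ⟨c, hc⟩ : ∃ c : ℕ, Fintype.card (Fin n → ℤˣ) = c := ⟨_, rfl⟩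
  have hcpos : (0 : ℝ) < c := by rw [← hc]; exact_mod_cast Fintype.card_pos
  have hsum : ∀ (g : Fin n → ℝ), ∑ δ : Fin n → ℤˣ, ‖radSum (fun i : Fin n => g i • x i) δ‖ₑ ^ 2 =
      ENNReal.ofReal (c * 𝔼 δ, ‖radSum (fun i : Fin n => g i • x i) δ‖ ^ 2) := by
    intro g
    simp only [enorm_sq_eq_ofReal]
    rw [← ENNReal.ofReal_sum_of_nonneg fun _ _ => by positivity,
      Fintype.expect_eq_sum_div_card, hc, mul_div_cancel₀ _ hcpos.ne']
  have hext : ∀ δ : Fin n → ℤˣ, ∃ δ' : ℕ → ℤˣ, ∀ i : Fin n, δ' i = δ i := fun δ =>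
    ⟨fun i => if h : i < n then δ ⟨i, h⟩ else 1, fun i => by simp⟩
  have hmeas : ∀ (a : ℝ → ℝ), Measurable a → ∀ δ : Fin n → ℤˣ, StronglyMeasurable fun g : ℕ → ℝ =>
      radSum (fun i : Fin n => a (g i) • x i) δ := fun a ha δ =>
    Finset.stronglyMeasurable_fun_sum _ fun i _ =>
      ((ha.comp (measurable_pi_apply (i : ℕ))).stronglyMeasurable.smul_const _).const_smul _
  have h1 : ∀ δ : Fin n → ℤˣ,
      gaussPath n x ^ 2 = ∫⁻ g, ‖radSum (fun i : Fin n => g i • x i) δ‖ₑ ^ 2 ∂gaussSeq := by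
    intro δ
    obtain ⟨δ', hδ'⟩ := hext δ
    rw [← gaussPath_sign n x δ', eLpNorm_two_sq]
    refine lintegral_congr fun g => ?_
    rw [Finset.sum_range, radSum]
    simp only [hδ']
    congr 3
    ext i
    exact smul_comm _ _ _
  have h2 : ∀ δ : Fin n → ℤˣ, ENNReal.ofReal (gaussAbs ^ 2) *
      ‖radSum (fun i : Fin n => x i) δ‖ₑ ^ 2 ≤
        ∫⁻ g, ‖radSum (fun i : Fin n => |g i| • x i) δ‖ₑ ^ 2 ∂gaussSeq := by
    intro δ
    have hgi : ∀ i : Fin n, Integrable (fun g : ℕ → ℝ => |g i|) gaussSeq := fun i => by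
      have : Integrable (fun y : ℝ => |y|) (gaussSeq.map fun g => g i) := by
        rw [map_eval_gaussSeq]
        exact ((memLp_id_gaussianReal 1).integrable le_rfl).abs
      exact this.comp_measurable (by fun_prop)
    have hI : ∀ i : Fin n, ∫ g : ℕ → ℝ, |g i| ∂gaussSeq = gaussAbs := fun i => by
      rw [gaussAbs, ← map_eval_gaussSeq i]
      exact (integral_map (μ := gaussSeq) (φ := fun g => g i) (measurable_pi_apply _).aemeasurable
        continuous_abs.aestronglyMeasurable).symm
    have h3 : ∫ g, radSum (fun i : Fin n => |g i| • x i) δ ∂gaussSeq =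
        gaussAbs • radSum (fun i : Fin n => x i) δ := by
      simp only [radSum]
      rw [integral_finsetSum Finset.univ (f := fun (i : Fin n) (g : ℕ → ℝ) => signVal (δ i) • |g i| • x i)
        fun i _ => ((hgi i).smul_const (x i)).fun_smul (signVal (δ i)), Finset.smul_sum]
      refine Finset.sum_congr rfl fun i _ => ?_
      rw [integral_smul, integral_smul_const, hI, smul_comm]
    have h4 : ‖gaussAbs • radSum (fun i : Fin n => x i) δ‖ₑ ≤
        eLpNorm (fun g : ℕ → ℝ => radSum (fun i : Fin n => |g i| • x i) δ) 2 gaussSeq := by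
      rw [← h3]
      refine (enorm_integral_le_lintegral_enorm _).trans ?_
      rw [← eLpNorm_one_eq_lintegral_enorm]
      exact eLpNorm_le_eLpNorm_of_exponent_le (by norm_num)
        (hmeas _ measurable_abs δ).aestronglyMeasurable
    rw [← eLpNorm_two_sq]
    refine le_trans (le_of_eq ?_) (pow_le_pow_left' h4 2)
    rw [enorm_smul, mul_pow, Real.enorm_eq_ofReal gaussAbs_pos.le,
      ENNReal.ofReal_pow gaussAbs_pos.le]
  have h3 : ∀ g : Fin n → ℝ,
      ∑ δ : Fin n → ℤˣ, ‖radSum (fun i : Fin n => g i • x i) δ‖ₑ ^ 2 =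
      ∑ δ : Fin n → ℤˣ, ‖radSum (fun i : Fin n => |g i| • x i) δ‖ₑ ^ 2 := by
    intro g
    let δ₀ : Fin n → ℤˣ := fun i => if 0 ≤ g i then 1 else -1
    have h4 : ∀ i, |g i| = signVal (δ₀ i) * g i := fun i => by
      by_cases h : 0 ≤ g i
      · simp [δ₀, h, abs_of_nonneg h]
      · simp [δ₀, h, abs_of_neg (not_le.1 h)]
    rw [← Equiv.sum_comp (Equiv.mulLeft δ₀)]
    refine Finset.sum_congr rfl fun δ _ => ?_
    simp only [Equiv.coe_mulLeft, radSum_mul, h4, smul_smul]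
  have h5 : ∑ δ : Fin n → ℤˣ, ENNReal.ofReal (gaussAbs ^ 2) *
      ‖radSum (fun i : Fin n => x i) δ‖ₑ ^ 2 ≤ ∑ _δ : Fin n → ℤˣ, gaussPath n x ^ 2 := by
    refine (Finset.sum_le_sum fun δ _ => h2 δ).trans (le_of_eq ?_)
    have hA : ∀ δ : Fin n → ℤˣ, Measurable fun g : ℕ → ℝ =>
        ‖radSum (fun i : Fin n => |g i| • x i) δ‖ₑ ^ 2 :=
      fun δ => (hmeas _ measurable_abs δ).enorm.pow_const 2
    have hB : ∀ δ : Fin n → ℤˣ, Measurable fun g : ℕ → ℝ =>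
        ‖radSum (fun i : Fin n => g i • x i) δ‖ₑ ^ 2 :=
      fun δ => (hmeas _ measurable_id δ).enorm.pow_const 2
    rw [Finset.sum_congr rfl fun δ _ => h1 δ, ← lintegral_finsetSum _ fun δ _ => hA δ,
      ← lintegral_finsetSum _ fun δ _ => hB δ]
    exact lintegral_congr fun g => (h3 fun i => g i).symm
  have h6 := hsum 1
  simp only [Pi.one_apply, one_smul] at h6
  rw [← Finset.mul_sum, h6, Finset.sum_const, Finset.card_univ, hc, nsmul_eq_mul,
    ← ENNReal.ofReal_natCast, ← ENNReal.ofReal_mul (by positivity), mul_left_comm,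
    ENNReal.ofReal_mul hcpos.le] at h5
  exact (ENNReal.mul_le_mul_iff_right (ENNReal.ofReal_pos.2 hcpos).ne' ENNReal.ofReal_ne_top).1 h5

end Gaussian

/-! ### Doob's maximal inequality -/

section Doob

variable {Ω : Type*} {m : MeasurableSpace Ω} {ℱ : Filtration ℕ m} {P : Measure Ω}
  [IsProbabilityMeasure P]

/-- The running maximum of a real process. -/
def runMax (Y : ℕ → Ω → ℝ) (n : ℕ) (ω : Ω) : ℝ :=
  (Finset.range (n + 1)).sup' Finset.nonempty_range_add_one fun k => Y k ω

lemma runMax_weak {Y : ℕ → Ω → ℝ} (hY : Submartingale Y ℱ P) (h0 : 0 ≤ Y) (n : ℕ) {t : ℝ}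
    (ht : 0 < t) : ENNReal.ofReal t * P {ω | 2 * t ≤ runMax Y n ω} ≤
      P.withDensity (fun ω => ENNReal.ofReal (Y n ω)) {ω | t ≤ Y n ω} := by
  have hm : ∀ k, Measurable (Y k) := fun k => ((hY.1 k).mono (ℱ.le k)).measurable
  have hM : Measurable (runMax Y n) := by
    unfold runMax
    exact Finset.measurable_range_sup'' fun k _ => hm k
  set E := {ω | 2 * t ≤ runMax Y n ω} with hE
  have hEm : MeasurableSet E := measurableSet_le measurable_const hM
  have h1 := maximal_ineq hY h0 (ε := (2 * t).toNNReal) n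
  rw [Real.coe_toNNReal _ (by positivity)] at h1
  change (ENNReal.ofReal (2 * t)) * P E ≤ ENNReal.ofReal (∫ ω in E, Y n ω ∂P) at h1
  rw [ofReal_integral_eq_lintegral_ofReal (hY.2.2 n).integrableOn
    (.of_forall fun ω => h0 n ω)] at h1
  have h2 : ∫⁻ ω in E, ENNReal.ofReal (Y n ω) ∂P ≤
      P.withDensity (fun ω => ENNReal.ofReal (Y n ω)) {ω | t ≤ Y n ω} +
        ENNReal.ofReal t * P E := by
    have hs : MeasurableSet {ω | t ≤ Y n ω} := measurableSet_le measurable_const (hm n)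
    calc ∫⁻ ω in E, ENNReal.ofReal (Y n ω) ∂P
        ≤ ∫⁻ ω in E, ({ω | t ≤ Y n ω}.indicator (fun ω => ENNReal.ofReal (Y n ω)) ω +
            ENNReal.ofReal t) ∂P := by
          refine lintegral_mono fun ω => ?_
          by_cases h : t ≤ Y n ω
          · simp [h]
          · simp only [Set.indicator, Set.mem_ofPred_eq, h, if_false, zero_add]
            exact ENNReal.ofReal_le_ofReal (not_le.1 h).le
      _ = (∫⁻ ω in E, {ω | t ≤ Y n ω}.indicator (fun ω => ENNReal.ofReal (Y n ω)) ω ∂P) +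
            ENNReal.ofReal t * P E := by
          rw [lintegral_add_right _ measurable_const, setLIntegral_const]
      _ ≤ _ := by
          gcongr
          refine (setLIntegral_le_lintegral _ _).trans ?_
          rw [lintegral_indicator hs, withDensity_apply _ hs]
  have h3 := h1.trans h2
  rw [two_mul, ENNReal.ofReal_add ht.le ht.le, add_mul] at h3
  exact ENNReal.le_of_add_le_add_right
    (ENNReal.mul_ne_top ENNReal.ofReal_ne_top (measure_ne_top _ _)) h3

/-- **Doob's maximal inequality** in `L^p`. -/
lemma lintegral_runMax_rpow_le {Y : ℕ → Ω → ℝ} (hY : Submartingale Y ℱ P) (h0 : 0 ≤ Y)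
    {p : ℝ} (hp : 1 < p) (n : ℕ) :
    ∫⁻ ω, ENNReal.ofReal (runMax Y n ω) ^ p ∂P ≤
      ENNReal.ofReal (2 ^ p * (p / (p - 1))) * ∫⁻ ω, ENNReal.ofReal (Y n ω) ^ p ∂P := by
  have hm : ∀ k, Measurable (Y k) := fun k => ((hY.1 k).mono (ℱ.le k)).measurable
  have hM : Measurable (runMax Y n) := by
    unfold runMax
    exact Finset.measurable_range_sup'' fun k _ => hm k
  have hM0 : ∀ ω, 0 ≤ runMax Y n ω := fun ω =>
    (h0 0 ω).trans (Finset.le_sup' (fun k => Y k ω) (by simp))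
  set Q := P.withDensity fun ω => ENNReal.ofReal (Y n ω) with hQ
  have hp0 : 0 < p := by linarith
  have hp1 : 0 < p - 1 := by linarith
  have e1 : ∫⁻ ω, ENNReal.ofReal ((runMax Y n ω / 2) ^ p) ∂P = _ :=
    lintegral_rpow_eq_lintegral_meas_le_mul P (f := fun ω => runMax Y n ω / 2)
      (.of_forall fun ω => div_nonneg (hM0 ω) zero_le_two) (hM.div_const 2).aemeasurable hp0
  have e2 : ∫⁻ ω, ENNReal.ofReal (Y n ω ^ (p - 1)) ∂Q = _ :=
    lintegral_rpow_eq_lintegral_meas_le_mul Q (f := Y n)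
      (.of_forall fun ω => h0 n ω) (hm n).aemeasurable hp1
  have e3 : ∫⁻ ω, ENNReal.ofReal (Y n ω ^ (p - 1)) ∂Q =
      ∫⁻ ω, ENNReal.ofReal (Y n ω) ^ p ∂P := by
    rw [hQ, lintegral_withDensity_eq_lintegral_mul _ (hm n).ennreal_ofReal
      ((hm n).pow_const _).ennreal_ofReal]
    refine lintegral_congr fun ω => ?_
    rw [Pi.mul_apply, ← ENNReal.ofReal_mul (h0 n ω), ENNReal.ofReal_rpow_of_nonneg (h0 n ω) hp0.le]
    congr 1
    rcases (h0 n ω).eq_or_lt with h | h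
    · rw [← h]; simp [Real.zero_rpow hp0.ne']
    · nth_rewrite 1 [← Real.rpow_one (Y n ω)]
      rw [← Real.rpow_add h]; congr 1; ring
  have e4 : ∫⁻ t in Set.Ioi 0, P {ω | t ≤ runMax Y n ω / 2} * ENNReal.ofReal (t ^ (p - 1)) ≤
      ∫⁻ t in Set.Ioi 0, Q {ω | t ≤ Y n ω} * ENNReal.ofReal (t ^ (p - 1 - 1)) := by
    refine setLIntegral_mono' measurableSet_Ioi fun t ht => ?_
    have ht : 0 < t := ht
    have h1 := runMax_weak hY h0 n ht
    have h2 : {ω | t ≤ runMax Y n ω / 2} = {ω | 2 * t ≤ runMax Y n ω} := by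
      ext ω
      simp only [Set.mem_ofPred_eq]
      rw [le_div_iff₀ two_pos, mul_comm]
    have h3 : t ^ (p - 1) = t * t ^ (p - 1 - 1) := by
      rw [Real.rpow_sub_one ht.ne' (p - 1)]; field_simp
    rw [h2, h3, ENNReal.ofReal_mul ht.le, ← mul_assoc, mul_comm (P _)]
    gcongr
  rw [e3] at e2
  have e5 : ∀ ω, ENNReal.ofReal (runMax Y n ω) ^ p =
      ENNReal.ofReal (2 ^ p) * ENNReal.ofReal ((runMax Y n ω / 2) ^ p) := fun ω => by
    rw [ENNReal.ofReal_rpow_of_nonneg (hM0 ω) hp0.le, ← ENNReal.ofReal_mul (by positivity),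
      ← Real.mul_rpow zero_le_two (div_nonneg (hM0 ω) zero_le_two), mul_div_cancel₀ _ two_ne_zero]
  simp only [e5]
  rw [lintegral_const_mul _ (by fun_prop), e1, e2, ENNReal.ofReal_mul (by positivity), mul_assoc]
  refine mul_le_mul_right ?_ _
  rw [← mul_assoc, ← ENNReal.ofReal_mul (by positivity), div_mul_cancel₀ _ hp1.ne']
  gcongr

variable {X : Type*} [NormedAddCommGroup X] [NormedSpace ℝ X] [CompleteSpace X]

/-- The norm of a martingale is a submartingale. -/
lemma submartingale_norm {f : ℕ → Ω → X} (hf : Martingale f ℱ P) :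
    Submartingale (fun n ω => ‖f n ω‖) ℱ P := by
  refine submartingale_nat (fun n => (hf.1 n).norm) (fun n => (hf.integrable n).norm) fun n => ?_
  filter_upwards [norm_condExp_le (m := ℱ n) (μ := P) (f (n + 1)), hf.condExp_ae_eq n.le_succ]
    with ω h1 h2
  rwa [h2] at h1

/-- The maximum of the norms of the partial sums of length at most `n`. -/
def maxPath (n : ℕ) (x : ℕ → X) : ℝ≥0∞ :=
  (Finset.range (n + 1)).sup fun k => ‖∑ j ∈ Finset.range k, x j‖ₑ

lemma lintegral_maxPath_rpow_le {d : ℕ → Ω → X} (hd : IsMartDiffSeq ℱ P d) {p : ℝ} (hp : 1 < p)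
    (n : ℕ) : ∫⁻ ω, maxPath n (fun k => d k ω) ^ p ∂P ≤
      ENNReal.ofReal (2 ^ p * (p / (p - 1))) *
        ∫⁻ ω, ‖∑ j ∈ Finset.range n, d j ω‖ₑ ^ p ∂P := by
  have h := lintegral_runMax_rpow_le (submartingale_norm hd) (fun n ω => norm_nonneg _) hp n
  simp only [ofReal_norm] at h
  refine le_trans (lintegral_mono fun ω => ?_) h
  refine ENNReal.rpow_le_rpow (Finset.sup_le fun k hk => ?_) (by linarith)
  rw [← ofReal_norm]
  exact ENNReal.ofReal_le_ofReal
    (Finset.le_sup' (fun k => ‖∑ j ∈ Finset.range k, d j ω‖) hk)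

end Doob

/-! ### The `L^p` estimates for `p > 1` -/

section Lp

open scoped BigOperators

variable {X : Type*} [NormedAddCommGroup X] [NormedSpace ℝ X] [CompleteSpace X]

lemma gaussPath_rpow_equiv (hX : IsUMD X) {p : ℝ} (hp : 1 ≤ p) : ∃ K : ℝ, 0 < K ∧
    ∀ (n : ℕ) (x : ℕ → X),
      gaussPath n x ^ p ≤
        ENNReal.ofReal (K * 𝔼 ε, ‖radSum (fun i : Fin n => x i) ε‖ ^ p) ∧
      ENNReal.ofReal (𝔼 ε, ‖radSum (fun i : Fin n => x i) ε‖ ^ p) ≤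
        ENNReal.ofReal K * gaussPath n x ^ p := by
  obtain ⟨K, hK, hKa⟩ := kahane (X := X) p hp
  obtain ⟨C, hC, hCa⟩ := umd_gaussian_le_radSum hX
  have hg := gaussAbs_pos
  have hp0 : 0 ≤ p := by linarith
  have hsq : ∀ y : ℝ≥0∞, (y ^ 2) ^ (p / 2) = y ^ p := fun y => by
    rw [← ENNReal.rpow_natCast, ← ENNReal.rpow_mul]; congr 1; push_cast; ring
  have hsqr : ∀ a s : ℝ, 0 ≤ a → 0 ≤ s → (a * s) ^ (p / 2) = √a ^ p * √s ^ p := fun a s ha hs => by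
    rw [← Real.mul_rpow (Real.sqrt_nonneg _) (Real.sqrt_nonneg _), ← Real.sqrt_mul ha,
      Real.sqrt_eq_rpow, ← Real.rpow_mul (mul_nonneg ha hs)]
    congr 1; ring
  refine ⟨max (√C ^ p * K) (K / gaussAbs ^ p), lt_max_of_lt_right (by positivity), fun n x => ?_⟩
  set S := 𝔼 ε, ‖radSum (fun i : Fin n => x i) ε‖ ^ 2 with hS
  set T := 𝔼 ε, ‖radSum (fun i : Fin n => x i) ε‖ ^ p with hT
  have hS0 : 0 ≤ S := expect_nonneg' fun ε => by positivity
  have hT0 : 0 ≤ T := expect_nonneg' fun ε => by positivity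
  obtain ⟨k1, k2⟩ := hKa n fun i => x i
  rw [← hS, ← hT] at k1 k2
  constructor
  · have h1 := hCa n fun i => x i
    rw [← gaussPath_sq] at h1
    have h2 := ENNReal.rpow_le_rpow h1 (z := p / 2) (by positivity)
    rw [hsq, ENNReal.ofReal_rpow_of_nonneg (by positivity) (by positivity),
      hsqr _ _ hC.le hS0] at h2
    refine h2.trans (ENNReal.ofReal_le_ofReal ?_)
    calc √C ^ p * √S ^ p ≤ √C ^ p * (K * T) := by gcongr
      _ = (√C ^ p * K) * T := by ring
      _ ≤ _ := by gcongr; exact le_max_left _ _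
  · have h1 := radSum_le_gaussPath n x
    have h2 := ENNReal.rpow_le_rpow h1 (z := p / 2) (by positivity)
    rw [hsq, ENNReal.ofReal_rpow_of_nonneg (by positivity) (by positivity),
      hsqr _ _ (by positivity) hS0, Real.sqrt_sq hg.le] at h2
    calc ENNReal.ofReal T ≤ ENNReal.ofReal (K / gaussAbs ^ p * (gaussAbs ^ p * √S ^ p)) := by
          refine ENNReal.ofReal_le_ofReal (k1.trans (le_of_eq ?_))
          field_simp
      _ ≤ ENNReal.ofReal (K / gaussAbs ^ p) * gaussPath n x ^ p := by
          rw [ENNReal.ofReal_mul (by positivity)]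
          gcongr
      _ ≤ _ := by gcongr; exact le_max_right _ _

lemma lintegral_ofReal_expect {Ω : Type*} {m : MeasurableSpace Ω} (P : Measure Ω) {κ : Type*}
    [Fintype κ] [Nonempty κ] {f : κ → Ω → ℝ} (h0 : ∀ i ω, 0 ≤ f i ω)
    (hf : ∀ i, Measurable (f i)) :
    ∫⁻ ω, ENNReal.ofReal (𝔼 i, f i ω) ∂P =
      (Fintype.card κ : ℝ≥0∞)⁻¹ * ∑ i, ∫⁻ ω, ENNReal.ofReal (f i ω) ∂P := by
  have h1 : ∀ ω, ENNReal.ofReal (𝔼 i, f i ω) =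
      (Fintype.card κ : ℝ≥0∞)⁻¹ * ∑ i, ENNReal.ofReal (f i ω) := fun ω => by
    rw [Fintype.expect_eq_sum_div_card, div_eq_inv_mul, ENNReal.ofReal_mul (by positivity),
      ENNReal.ofReal_inv_of_pos (by exact_mod_cast Fintype.card_pos), ENNReal.ofReal_natCast,
      ENNReal.ofReal_sum_of_nonneg fun i _ => h0 i ω]
  simp only [h1]
  rw [lintegral_const_mul _ (Finset.measurable_fun_sum _ fun i _ => (hf i).ennreal_ofReal),
    lintegral_finsetSum _ fun i _ => (hf i).ennreal_ofReal]

lemma inv_card_mul_sum_const {κ : Type*} [Fintype κ] [Nonempty κ] (c : ℝ≥0∞) :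
    (Fintype.card κ : ℝ≥0∞)⁻¹ * ∑ _i : κ, c = c := by
  rw [Finset.sum_const, Finset.card_univ, nsmul_eq_mul, ← mul_assoc, ENNReal.inv_mul_cancel
    (by exact_mod_cast Fintype.card_ne_zero) (ENNReal.natCast_ne_top _), one_mul]

/-- Comparison of a UMD martingale with the average of its martingale transforms. -/
lemma umd_rad_average (hX : IsUMD X) {p : ℝ} (hp : 1 < p) : ∃ β : ℝ, 0 < β ∧
    ∀ (Ω : Type) (m : MeasurableSpace Ω) (P : Measure Ω), IsProbabilityMeasure P →
      ∀ (ℱ : Filtration ℕ m) (d : ℕ → Ω → X), IsMartDiffSeq ℱ P d → ∀ n : ℕ,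
        ∫⁻ ω, ENNReal.ofReal (𝔼 ε, ‖radSum (fun i : Fin n => d i ω) ε‖ ^ p) ∂P ≤
          ENNReal.ofReal β * ∫⁻ ω, ‖∑ j ∈ Finset.range n, d j ω‖ₑ ^ p ∂P ∧
        ∫⁻ ω, ‖∑ j ∈ Finset.range n, d j ω‖ₑ ^ p ∂P ≤ ENNReal.ofReal β *
          ∫⁻ ω, ENNReal.ofReal (𝔼 ε, ‖radSum (fun i : Fin n => d i ω) ε‖ ^ p) ∂P := by
  obtain ⟨β, hβ, h⟩ := hX.lintegral_le hp
  refine ⟨β, hβ, fun Ω m P hP ℱ d hd n => ?_⟩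
  have hp0 : 0 ≤ p := by linarith
  have hdm : ∀ k, StronglyMeasurable (d k) := fun k => (hd.stronglyMeasurable k).mono (ℱ.le _)
  have hrm : ∀ ε : Fin n → ℤˣ, StronglyMeasurable fun ω => radSum (fun i : Fin n => d i ω) ε :=
    fun ε => Finset.stronglyMeasurable_fun_sum _ fun i _ => (hdm i).const_smul _
  have hext : ∀ δ : Fin n → ℤˣ, ∃ e : ℕ → ℝ, (∀ j, e j = 1 ∨ e j = -1) ∧
      ∀ ω, ∑ j ∈ Finset.range n, e j • d j ω = radSum (fun i : Fin n => d i ω) δ := fun δ => by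
    refine ⟨fun i => if h : i < n then signVal (δ ⟨i, h⟩) else 1, fun j => ?_, fun ω => ?_⟩
    · by_cases h : j < n
      · simp only [h, dif_pos]
        rcases Int.units_eq_one_or (δ ⟨j, h⟩) with h | h <;> simp [h]
      · simp [h]
    · rw [Finset.sum_range, radSum]
      simp
  have key : ∀ δ : Fin n → ℤˣ,
      ∫⁻ ω, ENNReal.ofReal (‖radSum (fun i : Fin n => d i ω) δ‖ ^ p) ∂P ≤
        ENNReal.ofReal β * ∫⁻ ω, ‖∑ j ∈ Finset.range n, d j ω‖ₑ ^ p ∂P ∧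
      ∫⁻ ω, ‖∑ j ∈ Finset.range n, d j ω‖ₑ ^ p ∂P ≤ ENNReal.ofReal β *
        ∫⁻ ω, ENNReal.ofReal (‖radSum (fun i : Fin n => d i ω) δ‖ ^ p) ∂P := by
    intro δ
    obtain ⟨e, he, hs⟩ := hext δ
    have e1 : ∀ ω, ENNReal.ofReal (‖radSum (fun i : Fin n => d i ω) δ‖ ^ p) =
        ‖∑ j ∈ Finset.range n, e j • d j ω‖ₑ ^ p := fun ω => by
      rw [hs, ← ofReal_norm, ENNReal.ofReal_rpow_of_nonneg (norm_nonneg _) hp0]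
    simp only [e1]
    refine ⟨h Ω m P hP ℱ d hd e he n, ?_⟩
    have hd' : IsMartDiffSeq ℱ P fun k ω => e k • d k ω :=
      hd.smul_predictable (a := fun k _ => e k) (M := 1) (fun k => stronglyMeasurable_const)
        fun k ω => by rcases he k with h | h <;> simp [h]
    have h2 := h Ω m P hP ℱ _ hd' e he n
    have e2 : ∀ (j : ℕ) ω, e j • e j • d j ω = d j ω := fun j ω => by
      rcases he j with h | h <;> simp [h]
    simpa only [e2] using h2
  rw [lintegral_ofReal_expect P (fun ε ω => by positivity)
    fun ε => ((hrm ε).norm.measurable.pow_const p)]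
  constructor
  · calc _ ≤ (Fintype.card (Fin n → ℤˣ) : ℝ≥0∞)⁻¹ * ∑ _δ : Fin n → ℤˣ,
          ENNReal.ofReal β * ∫⁻ ω, ‖∑ j ∈ Finset.range n, d j ω‖ₑ ^ p ∂P :=
          mul_le_mul_right (Finset.sum_le_sum fun δ _ => (key δ).1) _
      _ = _ := inv_card_mul_sum_const _
  · rw [← inv_card_mul_sum_const (κ := Fin n → ℤˣ) (∫⁻ ω, ‖∑ j ∈ Finset.range n, d j ω‖ₑ ^ p ∂P),
      mul_left_comm, Finset.mul_sum (a := ENNReal.ofReal β)]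
    exact mul_le_mul_right (Finset.sum_le_sum fun δ _ => (key δ).2) _

lemma lintegral_paths_rpow (hX : IsUMD X) {p : ℝ} (hp : 1 < p) : ∃ C : ℝ, 0 < C ∧
    ∀ (Ω : Type) (m : MeasurableSpace Ω) (P : Measure Ω), IsProbabilityMeasure P →
      ∀ (ℱ : Filtration ℕ m) (d : ℕ → Ω → X), IsMartDiffSeq ℱ P d → ∀ n : ℕ,
        ∫⁻ ω, gaussPath n (fun k => d k ω) ^ p ∂P ≤
          ENNReal.ofReal C * ∫⁻ ω, maxPath n (fun k => d k ω) ^ p ∂P ∧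
        ∫⁻ ω, maxPath n (fun k => d k ω) ^ p ∂P ≤
          ENNReal.ofReal C * ∫⁻ ω, gaussPath n (fun k => d k ω) ^ p ∂P := by
  obtain ⟨β, hβ, h⟩ := umd_rad_average hX hp
  obtain ⟨K, hK, hKa⟩ := gaussPath_rpow_equiv hX hp.le
  have hp0 : 0 < p := by linarith
  have hp1 : 0 < p - 1 := by linarith
  set D := 2 ^ p * (p / (p - 1)) with hD
  have hD0 : 0 < D := by positivity
  refine ⟨max (K * β) (D * β * K), lt_max_of_lt_left (by positivity),
    fun Ω m P hP ℱ d hd n => ⟨?_, ?_⟩⟩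
  · calc ∫⁻ ω, gaussPath n (fun k => d k ω) ^ p ∂P
        ≤ ∫⁻ ω, ENNReal.ofReal K *
            ENNReal.ofReal (𝔼 ε, ‖radSum (fun i : Fin n => d i ω) ε‖ ^ p) ∂P := by
          refine lintegral_mono fun ω => ?_
          rw [← ENNReal.ofReal_mul hK.le]
          exact (hKa n fun k => d k ω).1
      _ ≤ ENNReal.ofReal K * (ENNReal.ofReal β *
            ∫⁻ ω, ‖∑ j ∈ Finset.range n, d j ω‖ₑ ^ p ∂P) := by
          rw [lintegral_const_mul' _ _ ENNReal.ofReal_ne_top]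
          gcongr
          exact (h Ω m P hP ℱ d hd n).1
      _ ≤ ENNReal.ofReal (K * β) * ∫⁻ ω, maxPath n (fun k => d k ω) ^ p ∂P := by
          rw [ENNReal.ofReal_mul hK.le, mul_assoc]
          gcongr with ω
          exact Finset.le_sup (f := fun k => ‖∑ j ∈ Finset.range k, d j ω‖ₑ) (by simp)
      _ ≤ _ := by gcongr; exact le_max_left _ _
  · calc ∫⁻ ω, maxPath n (fun k => d k ω) ^ p ∂P
        ≤ ENNReal.ofReal D * ∫⁻ ω, ‖∑ j ∈ Finset.range n, d j ω‖ₑ ^ p ∂P :=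
          lintegral_maxPath_rpow_le hd hp n
      _ ≤ ENNReal.ofReal D * (ENNReal.ofReal β *
            ∫⁻ ω, ENNReal.ofReal K * gaussPath n (fun k => d k ω) ^ p ∂P) := by
          gcongr
          refine ((h Ω m P hP ℱ d hd n).2).trans ?_
          gcongr with ω
          exact (hKa n fun k => d k ω).2
      _ = ENNReal.ofReal (D * β * K) * ∫⁻ ω, gaussPath n (fun k => d k ω) ^ p ∂P := by
          rw [lintegral_const_mul' _ _ ENNReal.ofReal_ne_top, ENNReal.ofReal_mul (p := D * β) (by positivity),
            ENNReal.ofReal_mul hD0.le, mul_assoc, mul_assoc]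
      _ ≤ _ := by gcongr; exact le_max_right _ _

end Lp

/-! ### Path norms -/

/-- A family of seminorms on `X`-valued sequences, the `n`-th one depending on the first `n`
coordinates only, which grow with `n` in a way controlled by the coordinates. -/
structure PathNorm (X : Type*) [NormedAddCommGroup X] where
  toFun : ℕ → (ℕ → X) → ℝ≥0∞
  zero : ∀ x, toFun 0 x = 0
  congr : ∀ n x y, (∀ k < n, x k = y k) → toFun n x = toFun n y
  add_le : ∀ n x y, toFun n (x + y) ≤ toFun n x + toFun n y
  le_succ : ∀ n x, toFun n x ≤ toFun (n + 1) x
  succ_le : ∀ n x, toFun (n + 1) x ≤ toFun n x + ‖x n‖ₑ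
  enorm_le : ∀ n x, ‖x n‖ₑ ≤ 2 * toFun (n + 1) x
  measurable : ∀ {Ω : Type} {m : MeasurableSpace Ω} {n : ℕ} {d : ℕ → Ω → X},
    (∀ k < n, StronglyMeasurable (d k)) → Measurable fun ω => toFun n fun k => d k ω

namespace PathNorm

variable {X : Type*} [NormedAddCommGroup X] (A : PathNorm X)

lemma mono (x : ℕ → X) : Monotone fun n => A.toFun n x :=
  monotone_nat_of_le_succ fun n => A.le_succ n x

lemma le_sum (n : ℕ) (x : ℕ → X) : A.toFun n x ≤ ∑ k ∈ Finset.range n, ‖x k‖ₑ := by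
  induction n with
  | zero => simp [A.zero]
  | succ n ih =>
    rw [Finset.sum_range_succ]
    exact (A.succ_le n x).trans (by gcongr)

lemma ne_top (n : ℕ) (x : ℕ → X) : A.toFun n x ≠ ∞ :=
  ((A.le_sum n x).trans_lt (ENNReal.sum_lt_top.2 fun _ _ => enorm_lt_top)).ne

end PathNorm

section Instances

variable (X : Type*) [NormedAddCommGroup X] [NormedSpace ℝ X]

/-- The path norm given by Gaussian sums. -/
def gaussPathNorm : PathNorm X where
  toFun := gaussPath
  zero x := by simp [gaussPath]
  congr n x y h := by
    rw [gaussPath, gaussPath]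
    congr 1
    ext g
    exact Finset.sum_congr rfl fun i hi => by rw [h i (Finset.mem_range.1 hi)]
  add_le := gaussPath_add_le
  le_succ := gaussPath_le_succ
  succ_le := gaussPath_succ_le
  enorm_le n x := (enorm_le_gaussPath_succ n x).trans (le_mul_of_one_le_left' one_le_two)
  measurable hd := measurable_gaussPath hd

variable {X} in
lemma maxPath_succ (n : ℕ) (x : ℕ → X) :
    maxPath (n + 1) x = max (maxPath n x) ‖∑ j ∈ Finset.range (n + 1), x j‖ₑ := by
  rw [maxPath, Finset.range_add_one, Finset.sup_insert, sup_comm]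
  rfl

variable {X} in
lemma enorm_sum_le_maxPath {n k : ℕ} (hk : k ≤ n) (x : ℕ → X) :
    ‖∑ j ∈ Finset.range k, x j‖ₑ ≤ maxPath n x :=
  Finset.le_sup (f := fun k => ‖∑ j ∈ Finset.range k, x j‖ₑ) (by simpa [Nat.lt_succ_iff] using hk)

/-- The path norm given by maxima of partial sums. -/
def maxPathNorm : PathNorm X where
  toFun := maxPath
  zero x := by simp [maxPath]
  congr n x y h := by
    refine Finset.sup_congr rfl fun k hk => ?_
    rw [Finset.sum_congr rfl fun j hj => h j ?_]
    simp only [Finset.mem_range] at hk hj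
    omega
  add_le n x y := by
    refine Finset.sup_le fun k hk => ?_
    have hk : k ≤ n := by simpa [Nat.lt_succ_iff] using hk
    simp only [Pi.add_apply, Finset.sum_add_distrib]
    exact (enorm_add_le _ _).trans
      (add_le_add (enorm_sum_le_maxPath hk x) (enorm_sum_le_maxPath hk y))
  le_succ n x := by rw [maxPath_succ]; exact le_max_left _ _
  succ_le n x := by
    rw [maxPath_succ]
    refine max_le le_self_add ?_
    rw [Finset.sum_range_succ]
    exact (enorm_add_le _ _).trans (by gcongr; exact enorm_sum_le_maxPath le_rfl x)
  enorm_le n x := by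
    have h : x n = (∑ j ∈ Finset.range (n + 1), x j) - ∑ j ∈ Finset.range n, x j := by
      simp [Finset.sum_range_succ]
    rw [h, two_mul]
    exact enorm_sub_le.trans
      (add_le_add (enorm_sum_le_maxPath le_rfl x) (enorm_sum_le_maxPath n.le_succ x))
  measurable {Ω m n d} hd := by
    have h : ∀ k ≤ n, Measurable fun ω => maxPath k fun j => d j ω := by
      intro k
      induction k with
      | zero => intro _; simp [maxPath]
      | succ k ih =>
        intro hk
        simp only [maxPath_succ]
        refine (ih (by omega)).max (StronglyMeasurable.enorm ?_)
        refine Finset.stronglyMeasurable_fun_sum _ fun j hj => hd j ?_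
        have := Finset.mem_range.1 hj
        omega
    exact h n le_rfl

end Instances

/-! ### Davis' decomposition -/

section Davis

lemma stronglyMeasurable_max {Ω : Type*} {m : MeasurableSpace Ω} {f g : Ω → ℝ}
    (hf : StronglyMeasurable f) (hg : StronglyMeasurable g) :
    StronglyMeasurable fun ω => max (f ω) (g ω) := hf.sup hg

variable {Ω X : Type*} [NormedAddCommGroup X] [NormedSpace ℝ X] [CompleteSpace X]
  {m : MeasurableSpace Ω} {ℱ : Filtration ℕ m} {P : Measure Ω} [IsProbabilityMeasure P]
  {d : ℕ → Ω → X}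

/-- The maximum of the norms of the first `n` terms. -/
def maxTerm (d : ℕ → Ω → X) : ℕ → Ω → ℝ
  | 0 => fun _ => 0
  | n + 1 => fun ω => max (maxTerm d n ω) ‖d n ω‖

lemma maxTerm_le_succ (n : ℕ) (ω : Ω) : maxTerm d n ω ≤ maxTerm d (n + 1) ω := le_max_left _ _

lemma norm_le_maxTerm_succ (n : ℕ) (ω : Ω) : ‖d n ω‖ ≤ maxTerm d (n + 1) ω := le_max_right _ _

lemma maxTerm_mono (ω : Ω) : Monotone fun n => maxTerm d n ω :=
  monotone_nat_of_le_succ fun n => maxTerm_le_succ n ω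

lemma maxTerm_nonneg (n : ℕ) (ω : Ω) : 0 ≤ maxTerm d n ω := maxTerm_mono ω (Nat.zero_le n)

lemma stronglyMeasurable_maxTerm (hd : IsMartDiffSeq ℱ P d) (n : ℕ) :
    StronglyMeasurable[ℱ n] (maxTerm d n) := by
  induction n with
  | zero => exact stronglyMeasurable_const
  | succ n ih =>
    exact stronglyMeasurable_max (ih.mono (ℱ.mono n.le_succ)) (hd.stronglyMeasurable n).norm

lemma integrable_maxTerm (hd : IsMartDiffSeq ℱ P d) (n : ℕ) : Integrable (maxTerm d n) P := by
  induction n with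
  | zero => exact integrable_zero _ _ _
  | succ n ih => exact ih.sup (hd.integrable n).norm

lemma PathNorm.ofReal_maxTerm_le (B : PathNorm X) (n : ℕ) (ω : Ω) :
    ENNReal.ofReal (maxTerm d n ω) ≤ 2 * B.toFun n fun k => d k ω := by
  induction n with
  | zero => simp [maxTerm]
  | succ n ih =>
    rw [maxTerm, ENNReal.ofReal_max, ofReal_norm]
    exact max_le (ih.trans (mul_le_mul_right (B.le_succ n _) _)) (B.enorm_le n _)

/-- **Davis' decomposition**: a martingale difference sequence is the sum of one with predictable
bounds and one with summable terms. -/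
lemma IsMartDiffSeq.davis_decomposition (hd : IsMartDiffSeq ℱ P d) :
    ∃ a : ℕ → Ω → X, IsMartDiffSeq ℱ P a ∧
      (∀ k, ∀ᵐ ω ∂P, ‖a k ω‖ ≤ 4 * maxTerm d k ω) ∧
      ∀ n, ∑ k ∈ Finset.range n, ∫⁻ ω, ‖d k ω - a k ω‖ₑ ∂P ≤
        4 * ∫⁻ ω, ENNReal.ofReal (maxTerm d n ω) ∂P := by
  set S : ℕ → Set Ω := fun k => {ω | ‖d k ω‖ ≤ 2 * maxTerm d k ω} with hS
  have hSm : ∀ k, MeasurableSet[ℱ (k + 1)] (S k) := fun k =>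
    StronglyMeasurable.measurableSet_le (hd.stronglyMeasurable k).norm
      (((stronglyMeasurable_maxTerm hd k).mono (ℱ.mono k.le_succ)).const_mul 2)
  set u : ℕ → Ω → X := fun k => (S k).indicator (d k) with hu
  have hum : ∀ k, StronglyMeasurable[ℱ (k + 1)] (u k) := fun k =>
    (hd.stronglyMeasurable k).indicator (hSm k)
  have hui : ∀ k, Integrable (u k) P := fun k =>
    (hd.integrable k).indicator (ℱ.le _ _ (hSm k))
  have hub : ∀ k ω, ‖u k ω‖ ≤ 2 * maxTerm d k ω := fun k ω => by
    by_cases h : ω ∈ S k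
    · simp only [hu, Set.indicator_of_mem h]
      exact h
    · simp only [hu, Set.indicator_of_notMem h, norm_zero]
      exact mul_nonneg zero_le_two (maxTerm_nonneg k ω)
  have hv : ∀ k ω, ‖d k ω - u k ω‖ ≤ 2 * (maxTerm d (k + 1) ω - maxTerm d k ω) := fun k ω => by
    have h1 := maxTerm_le_succ (d := d) k ω
    have h2 := norm_le_maxTerm_succ (d := d) k ω
    by_cases h : ω ∈ S k
    · simp only [hu, Set.indicator_of_mem h, sub_self, norm_zero]
      linarith
    · simp only [hu, Set.indicator_of_notMem h, sub_zero]
      have h : 2 * maxTerm d k ω < ‖d k ω‖ := not_le.1 h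
      linarith
  have hvi : ∀ k, Integrable (d k - u k) P := fun k => (hd.integrable k).sub (hui k)
  refine ⟨fun k => u k - P[u k | ℱ k], ?_, fun k => ?_, fun n => ?_⟩
  · refine isMartDiffSeq_of_condExp_eq_zero (fun k => ?_) (fun k => ?_) fun k => ?_
    · exact (hum k).sub (stronglyMeasurable_condExp.mono (ℱ.mono k.le_succ))
    · exact (hui k).sub integrable_condExp
    · refine (condExp_sub (hui k) integrable_condExp _).trans ?_
      rw [condExp_of_stronglyMeasurable (ℱ.le k) stronglyMeasurable_condExp integrable_condExp,
        sub_self]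
  · have h1 : P[fun ω => ‖u k ω‖ | ℱ k] ≤ᵐ[P] fun ω => 2 * maxTerm d k ω := by
      have h2 : P[fun ω => 2 * maxTerm d k ω | ℱ k] = fun ω => 2 * maxTerm d k ω :=
        condExp_of_stronglyMeasurable (ℱ.le k) ((stronglyMeasurable_maxTerm hd k).const_mul 2)
          ((integrable_maxTerm hd k).const_mul 2)
      conv_rhs => rw [← h2]
      exact condExp_mono (hui k).norm ((integrable_maxTerm hd k).const_mul 2)
        (.of_forall fun ω => hub k ω)
    filter_upwards [h1, norm_condExp_le (m := ℱ k) (μ := P) (u k)] with ω h1 h2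
    refine (norm_sub_le _ _).trans ?_
    linarith [hub k ω]
  · have h1 : ∀ k, ∫ ω, ‖d k ω - (u k - P[u k | ℱ k]) ω‖ ∂P ≤
        4 * (∫ ω, maxTerm d (k + 1) ω ∂P - ∫ ω, maxTerm d k ω ∂P) := by
      intro k
      have h2 : P[u k | ℱ k] =ᵐ[P] -P[d k - u k | ℱ k] := by
        filter_upwards [condExp_sub (hd.integrable k) (hui k) (ℱ k), hd.condExp_eq_zero k]
          with ω h1 h2
        rw [Pi.neg_apply, h1, Pi.sub_apply, h2]
        simp
      have h3 : ∫ ω, ‖(d k - u k) ω‖ ∂P ≤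
          2 * (∫ ω, maxTerm d (k + 1) ω ∂P - ∫ ω, maxTerm d k ω ∂P) := by
        rw [← integral_sub (integrable_maxTerm hd _) (integrable_maxTerm hd _),
          ← integral_const_mul]
        exact integral_mono (hvi k).norm
          (((integrable_maxTerm hd _).sub (integrable_maxTerm hd _)).const_mul 2) (hv k)
      have h4 := integral_norm_condExp_le (m := ℱ k) (μ := P) (d k - u k)
      calc ∫ ω, ‖d k ω - (u k - P[u k | ℱ k]) ω‖ ∂P
          ≤ ∫ ω, (‖(d k - u k) ω‖ + ‖P[d k - u k | ℱ k] ω‖) ∂P := by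
            refine integral_mono_ae
              ((hd.integrable k).sub ((hui k).sub integrable_condExp)).norm
              ((hvi k).norm.add integrable_condExp.norm) ?_
            filter_upwards [h2] with ω h2
            rw [Pi.sub_apply, h2, Pi.neg_apply, sub_neg_eq_add, ← sub_sub, Pi.sub_apply]
            exact norm_sub_le _ _
        _ = ∫ ω, ‖(d k - u k) ω‖ ∂P + ∫ ω, ‖P[d k - u k | ℱ k] ω‖ ∂P :=
            integral_add (hvi k).norm integrable_condExp.norm
        _ ≤ _ := by linarith
    have h2 : ∀ k, ∫⁻ ω, ‖d k ω - (u k - P[u k | ℱ k]) ω‖ₑ ∂P =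
        ENNReal.ofReal (∫ ω, ‖d k ω - (u k - P[u k | ℱ k]) ω‖ ∂P) := fun k =>
      (ofReal_integral_norm_eq_lintegral_enorm
        ((hd.integrable k).sub ((hui k).sub integrable_condExp))).symm
    rw [Finset.sum_congr rfl fun k _ => h2 k,
      ← ENNReal.ofReal_sum_of_nonneg fun k _ => integral_nonneg fun ω => norm_nonneg _,
      ← ofReal_integral_eq_lintegral_ofReal (integrable_maxTerm hd n)
        (.of_forall fun ω => maxTerm_nonneg n ω)]
    have h3 : (4 : ℝ≥0∞) = ENNReal.ofReal 4 := by simp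
    rw [h3, ← ENNReal.ofReal_mul (by norm_num)]
    refine ENNReal.ofReal_le_ofReal ((Finset.sum_le_sum fun k _ => h1 k).trans (le_of_eq ?_))
    rw [← Finset.mul_sum, Finset.sum_range_sub fun k => ∫ ω, maxTerm d k ω ∂P]
    simp [maxTerm]

end Davis

/-! ### Lenglart's argument -/

section Lenglart

lemma lintegral_min_sq_div_sq_le {v : ℝ} (hv : 0 ≤ v) :
    ∫⁻ t in Set.Ioi 0, ENNReal.ofReal (min v t ^ 2 / t ^ 2) ≤ 2 * ENNReal.ofReal v := by
  rcases hv.eq_or_lt with rfl | hv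
  · refine le_of_eq_of_le (setLIntegral_congr_fun measurableSet_Ioi fun t ht => ?_)
      (le_of_eq_of_le lintegral_zero zero_le)
    rw [min_eq_left (le_of_lt ht)]
    simp
  rw [← Set.Ioc_union_Ioi_eq_Ioi hv.le, two_mul]
  refine (lintegral_union_le _ _ _).trans (add_le_add ?_ ?_)
  · calc ∫⁻ t in Set.Ioc 0 v, ENNReal.ofReal (min v t ^ 2 / t ^ 2)
        ≤ ∫⁻ _t in Set.Ioc 0 v, 1 := by
          refine setLIntegral_mono' measurableSet_Ioc fun t ht => ?_
          rw [min_eq_right ht.2, div_self (pow_pos ht.1 2).ne', ENNReal.ofReal_one]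
      _ = ENNReal.ofReal v := by simp
  · have h1 : ∀ t ∈ Set.Ioi v, ENNReal.ofReal (min v t ^ 2 / t ^ 2) =
        ENNReal.ofReal (v ^ 2 * t ^ (-2 : ℝ)) := fun t ht => by
      have ht : v < t := ht
      rw [min_eq_left ht.le, Real.rpow_neg (hv.trans ht).le, div_eq_mul_inv]
      norm_cast
    rw [setLIntegral_congr_fun measurableSet_Ioi h1, ← ofReal_integral_eq_lintegral_ofReal
      ((integrableOn_Ioi_rpow_of_lt (by norm_num) hv).const_mul _)
      ((ae_restrict_mem measurableSet_Ioi).mono fun t ht => mul_nonneg (sq_nonneg v)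
        (Real.rpow_nonneg (hv.trans ht).le _)), integral_const_mul,
      integral_Ioi_rpow_of_lt (by norm_num) hv]
    refine ENNReal.ofReal_le_ofReal (le_of_eq ?_)
    have h2 : (-2 : ℝ) + 1 = -1 := by norm_num
    rw [h2, Real.rpow_neg_one]
    field_simp

/-- Integration of a tail estimate involving a truncated second moment. -/
lemma lintegral_le_of_truncated {Ω : Type*} {m : MeasurableSpace Ω} {P : Measure Ω}
    [IsProbabilityMeasure P] {f v : Ω → ℝ} (hf : Measurable f) (hv : Measurable v)
    (hf0 : ∀ ω, 0 ≤ f ω) (hv0 : ∀ ω, 0 ≤ v ω) {C : ℝ} (hC : 0 ≤ C)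
    (h : ∀ t : ℝ, 0 < t → P {ω | t ≤ f ω} ≤
      ENNReal.ofReal C * ∫⁻ ω, ENNReal.ofReal (min (v ω) t ^ 2 / t ^ 2) ∂P + P {ω | t ≤ v ω}) :
    ∫⁻ ω, ENNReal.ofReal (f ω) ∂P ≤
      ENNReal.ofReal (2 * C + 1) * ∫⁻ ω, ENNReal.ofReal (v ω) ∂P := by
  have hmeas : Measurable fun q : ℝ × Ω => ENNReal.ofReal (min (v q.2) q.1 ^ 2 / q.1 ^ 2) := by
    fun_prop
  have h1 : Measurable fun t : ℝ =>
      ENNReal.ofReal C * ∫⁻ ω, ENNReal.ofReal (min (v ω) t ^ 2 / t ^ 2) ∂P :=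
    (hmeas.lintegral_prod_right').const_mul _
  rw [lintegral_eq_lintegral_meas_le P (.of_forall hf0) hf.aemeasurable]
  calc ∫⁻ t in Set.Ioi 0, P {ω | t ≤ f ω}
      ≤ ∫⁻ t in Set.Ioi 0, (ENNReal.ofReal C *
          ∫⁻ ω, ENNReal.ofReal (min (v ω) t ^ 2 / t ^ 2) ∂P + P {ω | t ≤ v ω}) :=
        setLIntegral_mono' measurableSet_Ioi fun t ht => h t ht
    _ = ENNReal.ofReal C * (∫⁻ ω, (∫⁻ t in Set.Ioi (0 : ℝ),
          ENNReal.ofReal (min (v ω) t ^ 2 / t ^ 2)) ∂P) + ∫⁻ ω, ENNReal.ofReal (v ω) ∂P := by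
        rw [lintegral_add_left h1, lintegral_const_mul' _ _ ENNReal.ofReal_ne_top,
          lintegral_lintegral_swap hmeas.aemeasurable,
          ← lintegral_eq_lintegral_meas_le P (.of_forall hv0) hv.aemeasurable]
    _ ≤ ENNReal.ofReal C * (∫⁻ ω, 2 * ENNReal.ofReal (v ω) ∂P) +
          ∫⁻ ω, ENNReal.ofReal (v ω) ∂P := by
        gcongr with ω
        exact lintegral_min_sq_div_sq_le (hv0 ω)
    _ = _ := by
        rw [lintegral_const_mul' _ _ (by norm_num), ENNReal.ofReal_add (by positivity) zero_le_one,
          ENNReal.ofReal_mul zero_le_two]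
        simp only [ENNReal.ofReal_ofNat, ENNReal.ofReal_one]
        ring

end Lenglart

section PathNormEstimates

variable {X : Type*} [NormedAddCommGroup X] [NormedSpace ℝ X] [CompleteSpace X]

/-- The path norm `A` is dominated by `B` in `L^p` on martingale difference sequences. -/
def PathNorm.DominatedBy (A B : PathNorm X) (p C : ℝ) : Prop :=
  ∀ (Ω : Type) (m : MeasurableSpace Ω) (P : Measure Ω), IsProbabilityMeasure P →
    ∀ (ℱ : Filtration ℕ m) (d : ℕ → Ω → X), IsMartDiffSeq ℱ P d → ∀ n : ℕ,
      ∫⁻ ω, A.toFun n (fun k => d k ω) ^ p ∂P ≤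
        ENNReal.ofReal C * ∫⁻ ω, B.toFun n (fun k => d k ω) ^ p ∂P

variable {A B : PathNorm X} {Ω : Type} {m : MeasurableSpace Ω} {ℱ : Filtration ℕ m}
  {P : Measure Ω} [IsProbabilityMeasure P] {d : ℕ → Ω → X}

lemma PathNorm.measurable_of_isMartDiffSeq (B : PathNorm X) (hd : IsMartDiffSeq ℱ P d) (n : ℕ) :
    Measurable[ℱ n] fun ω => B.toFun n fun k => d k ω :=
  B.measurable (m := ℱ n) fun k hk => (hd.stronglyMeasurable k).mono (ℱ.mono hk)

/-- **Lenglart's domination argument** for martingale difference sequences with predictable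
bounds. -/
lemma PathNorm.DominatedBy.lintegral_le_of_predictable {C : ℝ} (hC : 0 < C)
    (h : A.DominatedBy B 2 C) (hd : IsMartDiffSeq ℱ P d) {w : ℕ → Ω → ℝ}
    (hw : ∀ k, StronglyMeasurable[ℱ k] (w k)) (hmono : ∀ k ω, w k ω ≤ w (k + 1) ω)
    (hw0 : ∀ k ω, 0 ≤ w k ω) (hdw : ∀ k, ∀ᵐ ω ∂P, ‖d k ω‖ ≤ w k ω) (n : ℕ) :
    ∫⁻ ω, A.toFun n (fun k => d k ω) ∂P ≤ ENNReal.ofReal (2 * C + 1) *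
      ∫⁻ ω, (B.toFun n (fun k => d k ω) + ENNReal.ofReal (w n ω)) ∂P := by
  set V : ℕ → Ω → ℝ := fun k ω => (B.toFun k fun k => d k ω).toReal + w k ω with hV
  have hVm : ∀ k, Measurable[ℱ k] (V k) := fun k =>
    (B.measurable_of_isMartDiffSeq hd k).ennreal_toReal.add (hw k).measurable
  have hVof : ∀ k ω, ENNReal.ofReal (V k ω) =
      B.toFun k (fun k => d k ω) + ENNReal.ofReal (w k ω) := fun k ω => by
    rw [hV, ENNReal.ofReal_add ENNReal.toReal_nonneg (hw0 k ω), ENNReal.ofReal_toReal (B.ne_top _ _)]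
  have hV0 : ∀ k ω, 0 ≤ V k ω := fun k ω => add_nonneg ENNReal.toReal_nonneg (hw0 k ω)
  have hVmono : ∀ ω, Monotone fun k => V k ω := fun ω =>
    monotone_nat_of_le_succ fun k =>
      add_le_add (ENNReal.toReal_mono (B.ne_top _ _) (B.le_succ k _)) (hmono k ω)
  have hAm : Measurable fun ω => A.toFun n fun k => d k ω :=
    (A.measurable_of_isMartDiffSeq hd n).mono (ℱ.le n) le_rfl
  have e1 : ∀ ω, A.toFun n (fun k => d k ω) =
      ENNReal.ofReal (A.toFun n fun k => d k ω).toReal := fun ω =>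
    (ENNReal.ofReal_toReal (A.ne_top _ _)).symm
  simp only [← hVof]
  rw [lintegral_congr e1]
  refine lintegral_le_of_truncated hAm.ennreal_toReal ((hVm n).mono (ℱ.le n) le_rfl)
    (fun ω => ENNReal.toReal_nonneg) (hV0 n) hC.le fun t ht => ?_
  set G : ℕ → Set Ω := fun k => {ω | V k ω < t} with hG
  have hGm : ∀ k, MeasurableSet[ℱ k] (G k) := fun k => hVm k measurableSet_Iio
  set d' : ℕ → Ω → X := fun k ω => (G k).indicator (fun _ => (1 : ℝ)) ω • d k ω with hd'
  have hd'M : IsMartDiffSeq ℱ P d' := by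
    refine hd.smul_predictable (M := 1)
      (fun k => stronglyMeasurable_const.indicator (hGm k)) fun k ω => ?_
    by_cases hk : ω ∈ G k <;> simp [hk]
  have hmem : ∀ k ω, ω ∈ G k → ∀ j ≤ k, d' j ω = d j ω := fun k ω hk j hj => by
    have : ω ∈ G j := lt_of_le_of_lt (hVmono ω hj) hk
    simp [hd', this]
  have hnotMem : ∀ k ω, ω ∉ G k → d' k ω = 0 := fun k ω hk => by simp [hd', hk]
  have hB : ∀ᵐ ω ∂P, B.toFun n (fun k => d' k ω) ≤ ENNReal.ofReal (min (V n ω) t) := by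
    filter_upwards [ae_all_iff.2 hdw] with ω hω
    have hind : ∀ k, B.toFun k (fun k => d' k ω) ≤ ENNReal.ofReal (min (V k ω) t) := by
      intro k
      induction k with
      | zero => simp [B.zero]
      | succ k ih =>
        by_cases hk : ω ∈ G k
        · rw [B.congr (k + 1) _ (fun k => d k ω)
            fun j hj => hmem k ω hk j (Nat.lt_succ_iff.1 hj), ENNReal.ofReal_min]
          refine le_min ?_ ?_
          · rw [hVof]; exact le_self_add
          · calc B.toFun (k + 1) (fun k => d k ω) ≤ B.toFun k (fun k => d k ω) + ‖d k ω‖ₑ :=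
                  B.succ_le _ _
              _ ≤ ENNReal.ofReal (V k ω) := by
                  rw [hVof, ← ofReal_norm]
                  gcongr
                  exact hω k
              _ ≤ _ := ENNReal.ofReal_le_ofReal (le_of_lt hk)
        · refine (B.succ_le _ _).trans ?_
          simp only [hnotMem k ω hk, enorm_zero, add_zero]
          refine ih.trans (ENNReal.ofReal_le_ofReal (min_le_min_right _ (hVmono ω k.le_succ)))
    exact hind n
  have hA'm : Measurable fun ω => A.toFun n fun k => d' k ω :=
    (A.measurable_of_isMartDiffSeq hd'M n).mono (ℱ.le n) le_rfl
  have ht2 : ENNReal.ofReal t ^ (2 : ℝ) ≠ 0 := by simp [ht]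
  have ht2' : ENNReal.ofReal t ^ (2 : ℝ) ≠ ∞ := by simp
  calc P {ω | t ≤ (A.toFun n fun k => d k ω).toReal}
      ≤ P ({ω | ENNReal.ofReal t ^ (2 : ℝ) ≤ A.toFun n (fun k => d' k ω) ^ (2 : ℝ)} ∪
          {ω | t ≤ V n ω}) := by
        refine measure_mono fun ω hω => ?_
        by_cases hn : t ≤ V n ω
        · exact Or.inr hn
        · refine Or.inl (ENNReal.rpow_le_rpow ?_ zero_le_two)
          rw [A.congr n _ (fun k => d k ω) fun j hj => hmem n ω (not_le.1 hn) j hj.le, e1]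
          exact ENNReal.ofReal_le_ofReal hω
    _ ≤ P {ω | ENNReal.ofReal t ^ (2 : ℝ) ≤ A.toFun n (fun k => d' k ω) ^ (2 : ℝ)} +
          P {ω | t ≤ V n ω} := measure_union_le _ _
    _ ≤ ENNReal.ofReal C * ∫⁻ ω, ENNReal.ofReal (min (V n ω) t ^ 2 / t ^ 2) ∂P +
          P {ω | t ≤ V n ω} := by
        gcongr
        refine (meas_ge_le_lintegral_div (hA'm.pow_const 2).aemeasurable ht2 ht2').trans ?_
        have e2 : ∀ ω, ENNReal.ofReal (min (V n ω) t ^ 2 / t ^ 2) =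
            (ENNReal.ofReal t ^ (2 : ℝ))⁻¹ * ENNReal.ofReal (min (V n ω) t) ^ (2 : ℝ) := fun ω => by
          rw [ENNReal.ofReal_div_of_pos (by positivity), ENNReal.rpow_ofNat, ENNReal.rpow_ofNat,
            ENNReal.ofReal_pow (le_min (hV0 n ω) ht.le), ENNReal.ofReal_pow ht.le,
            ENNReal.div_eq_inv_mul]
        simp only [e2]
        rw [lintegral_const_mul' _ _ (ENNReal.inv_ne_top.2 ht2), ENNReal.div_eq_inv_mul,
          mul_left_comm]
        refine mul_le_mul_right ((h Ω m P ‹_› ℱ d' hd'M n).trans ?_) _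
        refine mul_le_mul_right (lintegral_mono_ae ?_) _
        filter_upwards [hB] with ω hω
        exact ENNReal.rpow_le_rpow hω zero_le_two

lemma PathNorm.DominatedBy.one_of_two {C : ℝ} (hC : 0 < C) (h : A.DominatedBy B 2 C) :
    A.DominatedBy B 1 (17 * (2 * C + 1) + 8) := by
  intro Ω m P hP ℱ d hd n
  simp only [ENNReal.rpow_one]
  obtain ⟨a, ha, hab, hsum⟩ := hd.davis_decomposition
  have hdm : ∀ k, StronglyMeasurable (d k) := fun k => (hd.stronglyMeasurable k).mono (ℱ.le _)
  have ham : ∀ k, StronglyMeasurable (a k) := fun k => (ha.stronglyMeasurable k).mono (ℱ.le _)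
  have hbm : ∀ k, Measurable fun ω => ‖d k ω - a k ω‖ₑ := fun k => ((hdm k).sub (ham k)).enorm
  set R : Ω → ℝ≥0∞ := fun ω => ∑ k ∈ Finset.range n, ‖d k ω - a k ω‖ₑ with hR
  have hRm : Measurable R := Finset.measurable_fun_sum _ fun k _ => hbm k
  have hBm : Measurable fun ω => B.toFun n fun k => d k ω :=
    (B.measurable_of_isMartDiffSeq hd n).mono (ℱ.le n) le_rfl
  have hBam : Measurable fun ω => B.toFun n fun k => a k ω :=
    (B.measurable_of_isMartDiffSeq ha n).mono (ℱ.le n) le_rfl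
  set I := ∫⁻ ω, B.toFun n (fun k => d k ω) ∂P with hI
  have hD : ∫⁻ ω, ENNReal.ofReal (maxTerm d n ω) ∂P ≤ 2 * I := by
    rw [hI, ← lintegral_const_mul' _ _ (by norm_num)]
    exact lintegral_mono fun ω => B.ofReal_maxTerm_le n ω
  have hRI : ∫⁻ ω, R ω ∂P ≤ 8 * I := by
    rw [hR, lintegral_finsetSum _ fun k _ => hbm k]
    refine (hsum n).trans ((mul_le_mul_right hD 4).trans (le_of_eq ?_))
    rw [← mul_assoc]; norm_num
  have hBa : ∀ ω, B.toFun n (fun k => a k ω) ≤ B.toFun n (fun k => d k ω) + R ω := fun ω => by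
    have e : (fun k => a k ω) = (fun k => d k ω) + fun k => a k ω - d k ω := by ext k; simp
    rw [e]
    refine (B.add_le _ _ _).trans (add_le_add le_rfl ((B.le_sum _ _).trans (le_of_eq ?_)))
    exact Finset.sum_congr rfl fun k _ => enorm_sub_rev _ _
  have hAd : ∀ ω, A.toFun n (fun k => d k ω) ≤ A.toFun n (fun k => a k ω) + R ω := fun ω => by
    have e : (fun k => d k ω) = (fun k => a k ω) + fun k => d k ω - a k ω := by ext k; simp
    conv_lhs => rw [e]
    exact (A.add_le _ _ _).trans (add_le_add le_rfl (A.le_sum _ _))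
  have hL := h.lintegral_le_of_predictable hC ha (w := fun k ω => 4 * maxTerm d k ω)
    (fun k => (stronglyMeasurable_maxTerm hd k).const_mul 4)
    (fun k ω => mul_le_mul_of_nonneg_left (maxTerm_le_succ k ω) (by norm_num))
    (fun k ω => mul_nonneg (by norm_num) (maxTerm_nonneg k ω)) hab n
  have hV : ∫⁻ ω, (B.toFun n (fun k => a k ω) + ENNReal.ofReal (4 * maxTerm d n ω)) ∂P ≤
      17 * I := by
    rw [lintegral_add_left hBam]
    have h1 : ∫⁻ ω, B.toFun n (fun k => a k ω) ∂P ≤ I + 8 * I :=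
      (lintegral_mono hBa).trans (by rw [lintegral_add_left hBm]; gcongr)
    have h2 : ∫⁻ ω, ENNReal.ofReal (4 * maxTerm d n ω) ∂P ≤ 8 * I := by
      simp only [ENNReal.ofReal_mul (zero_le_four (α := ℝ)), ENNReal.ofReal_ofNat]
      rw [lintegral_const_mul' _ _ (by norm_num)]
      refine (mul_le_mul_right hD 4).trans (le_of_eq ?_)
      rw [← mul_assoc]; norm_num
    refine (add_le_add h1 h2).trans (le_of_eq ?_)
    ring
  calc ∫⁻ ω, A.toFun n (fun k => d k ω) ∂P
      ≤ ∫⁻ ω, (A.toFun n (fun k => a k ω) + R ω) ∂P := lintegral_mono hAd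
    _ = ∫⁻ ω, A.toFun n (fun k => a k ω) ∂P + ∫⁻ ω, R ω ∂P := lintegral_add_right _ hRm
    _ ≤ ENNReal.ofReal (2 * C + 1) * (17 * I) + 8 * I :=
        add_le_add (hL.trans (mul_le_mul_right hV _)) hRI
    _ = _ := by
        rw [ENNReal.ofReal_add (p := 17 * (2 * C + 1)) (q := 8) (by positivity) (by norm_num),
          ENNReal.ofReal_mul (p := 17) (by norm_num), add_mul]
        simp only [ENNReal.ofReal_ofNat]
        ring

/-- Maxima of partial sums and Gaussian sums are comparable in `L^p` for every `p ≥ 1`. -/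
lemma exists_dominatedBy (hX : IsUMD X) {p : ℝ} (hp : 1 ≤ p) : ∃ C : ℝ, 0 < C ∧
    (gaussPathNorm X).DominatedBy (maxPathNorm X) p C ∧
    (maxPathNorm X).DominatedBy (gaussPathNorm X) p C := by
  rcases hp.eq_or_lt with rfl | hp
  · obtain ⟨C, hC, h⟩ := lintegral_paths_rpow hX (p := 2) (by norm_num)
    refine ⟨17 * (2 * C + 1) + 8, by positivity, ?_, ?_⟩
    · exact PathNorm.DominatedBy.one_of_two hC fun Ω m P hP ℱ d hd n => (h Ω m P hP ℱ d hd n).1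
    · exact PathNorm.DominatedBy.one_of_two hC fun Ω m P hP ℱ d hd n => (h Ω m P hP ℱ d hd n).2
  · obtain ⟨C, hC, h⟩ := lintegral_paths_rpow hX hp
    exact ⟨C, hC, fun Ω m P hP ℱ d hd n => (h Ω m P hP ℱ d hd n).1,
      fun Ω m P hP ℱ d hd n => (h Ω m P hP ℱ d hd n).2⟩

lemma PathNorm.lintegral_iSup_rpow (A : PathNorm X) (hd : IsMartDiffSeq ℱ P d) {p : ℝ}
    (hp : 0 < p) : ∫⁻ ω, (⨆ n, A.toFun n fun k => d k ω) ^ p ∂P =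
      ⨆ n, ∫⁻ ω, A.toFun n (fun k => d k ω) ^ p ∂P := by
  have h : ∀ ω, (⨆ n, A.toFun n fun k => d k ω) ^ p = ⨆ n, A.toFun n (fun k => d k ω) ^ p :=
    fun ω => (ENNReal.orderIsoRpow p hp).map_iSup _
  rw [lintegral_congr h]
  refine lintegral_iSup (fun n => ?_) fun i j hij ω => ?_
  · exact ((A.measurable_of_isMartDiffSeq hd n).mono (ℱ.le n) le_rfl).pow_const p
  · exact ENNReal.rpow_le_rpow (A.mono _ hij) hp.le

lemma PathNorm.DominatedBy.lintegral_iSup_le {p C : ℝ} (hp : 0 < p) (h : A.DominatedBy B p C)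
    (hd : IsMartDiffSeq ℱ P d) : ∫⁻ ω, (⨆ n, A.toFun n fun k => d k ω) ^ p ∂P ≤
      ENNReal.ofReal C * ∫⁻ ω, (⨆ n, B.toFun n fun k => d k ω) ^ p ∂P := by
  rw [A.lintegral_iSup_rpow hd hp, B.lintegral_iSup_rpow hd hp, ENNReal.mul_iSup]
  exact iSup_mono fun n => h Ω m P ‹_› ℱ d hd n

lemma iSup_enorm_sum_eq (x : ℕ → X) :
    ⨆ M : ℕ, (‖∑ n ∈ Finset.range M, x n‖₊ : ℝ≥0∞) = ⨆ n, maxPath n x :=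
  le_antisymm (iSup_mono fun n => enorm_sum_le_maxPath le_rfl x)
    (iSup_le fun _ => Finset.sup_le fun k _ =>
      le_iSup (fun M : ℕ => (‖∑ n ∈ Finset.range M, x n‖₊ : ℝ≥0∞)) k)

end PathNormEstimates

/-- **Discrete Burkholder–Davis–Gundy inequalities in UMD spaces** (Theorem 2.1).
Let `X` be a UMD Banach space and `(d_n)` an `X`-valued martingale difference sequence.
Then for any `1 ≤ p < ∞`, `E sup_m ‖Σ_{n≤m} d_n‖^p ≍_{p,X} E ‖(d_n)‖_{γ(ℓ²,X)}^p`. -/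
theorem bdg_discrete_umd
    (X : Type*) [NormedAddCommGroup X] [NormedSpace ℝ X] [CompleteSpace X]
    (hX : IsUMD X) (p : ℝ) (hp : 1 ≤ p) :
    ∃ c C : ℝ, 0 < c ∧ 0 < C ∧
      ∀ (Ω : Type) (m : MeasurableSpace Ω) (P : Measure Ω), IsProbabilityMeasure P →
        ∀ (ℱ : Filtration ℕ m) (d : ℕ → Ω → X), IsMartDiffSeq ℱ P d →
          ENNReal.ofReal c * ∫⁻ ω, gammaSeqNorm (fun n => d n ω) ^ p ∂P ≤
              ∫⁻ ω, (⨆ M : ℕ, (‖∑ n ∈ Finset.range M, d n ω‖₊ : ℝ≥0∞)) ^ p ∂P ∧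
          (∫⁻ ω, (⨆ M : ℕ, (‖∑ n ∈ Finset.range M, d n ω‖₊ : ℝ≥0∞)) ^ p ∂P) ≤
              ENNReal.ofReal C * ∫⁻ ω, gammaSeqNorm (fun n => d n ω) ^ p ∂P := by
  obtain ⟨C, hC, h1, h2⟩ := exists_dominatedBy hX hp
  have hp0 : 0 < p := by linarith
  refine ⟨C⁻¹, C, inv_pos.2 hC, hC, fun Ω m P hP ℱ d hd => ?_⟩
  simp only [gammaSeqNorm_eq_iSup, iSup_enorm_sum_eq]
  refine ⟨?_, h2.lintegral_iSup_le hp0 hd⟩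
  rw [ENNReal.ofReal_inv_of_pos hC]
  exact (mul_le_mul_right (h1.lintegral_iSup_le hp0 hd) _).trans_eq (by
    rw [← mul_assoc, ENNReal.inv_mul_cancel (by simpa using hC) ENNReal.ofReal_ne_top, one_mul]
    rfl)

end
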